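/- Let n ≥ 21, d = 3n+2, and let Ψ be the Clebsch covariant of degree d. Then there exists g ∈ V(d) such that the set {Ψ(h,g,g,g) : h ∈ L_T} ∪ {Ψ(g,g,g,g)} spans the 45-dimensional space V(8). (Equivalently: the linear map obtained by restricting T_d : f ↦ Ψ(f,f,f,f) to ℙ(L_T + ℂg) is surjective onto ℙV(8).) -/

import Mathlib

open MvPolynomial

noncomputable section

/-- The polynomial ring ℂ[x₁,x₂,x₃]. -/
abbrev MvP : Type := MvPolynomial (Fin 3) ℂ

/-- The linear form a₁x₁+a₂x₂+a₃x₃ with coefficient vector a. -/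
def lin (a : Fin 3 → ℂ) : MvP := ∑ i, C (a i) * X i

lemma lin_hom (a : Fin 3 → ℂ) : (lin a).IsHomogeneous 1 := by
  unfold lin
  apply IsHomogeneous.sum
  intro i _
  simpa using (isHomogeneous_C (Fin 3) (a i)).mul (isHomogeneous_X ℂ i)

/-- V(k): the space of homogeneous polynomials of degree k in ℂ[x₁,x₂,x₃]. -/
def V (k : ℕ) : Submodule ℂ MvP := homogeneousSubmodule (Fin 3) ℂ k

/-- l^d as an element of V(d), where l is the linear form with coefficient vector a. -/
def powV (d : ℕ) (a : Fin 3 → ℂ) : V d :=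
  ⟨lin a ^ d, by rw [V, mem_homogeneousSubmodule]; simpa using (lin_hom a).pow d⟩

/-- The bracket (l₁l₂l₃) = det(vec l₁, vec l₂, vec l₃). -/
def br (a b c : Fin 3 → ℂ) : ℂ := Matrix.det (Matrix.of ![a, b, c])

/-- I(l₁,l₂,l₃,l₄) = (l₁l₂l₃)(l₁l₂l₄)(l₁l₃l₄)(l₂l₃l₄). -/
def Icov (a b c d : Fin 3 → ℂ) : ℂ := br a b c * br a b d * br a c d * br b c d

/-- l₁l₂l₃l₄ as an element of V(4). -/
def prod4 (a b c d : Fin 3 → ℂ) : V 4 :=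
  ⟨lin a * lin b * lin c * lin d, by
    rw [V, mem_homogeneousSubmodule]
    simpa using (((lin_hom a).mul (lin_hom b)).mul (lin_hom c)).mul (lin_hom d)⟩

/-- l₁²l₂²l₃²l₄² as an element of V(8). -/
def prod4sq (a b c d : Fin 3 → ℂ) : V 8 :=
  ⟨lin a ^ 2 * lin b ^ 2 * lin c ^ 2 * lin d ^ 2, by
    rw [V, mem_homogeneousSubmodule]
    simpa using ((((lin_hom a).pow 2).mul ((lin_hom b).pow 2)).mul ((lin_hom c).pow 2)).mul
      ((lin_hom d).pow 2)⟩

/-- Φ is a Clebsch covariant of degree d = 3n+1: a symmetric quadrilinear map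
V(d)⁴ → V(4) with Φ(l₁^d,l₂^d,l₃^d,l₄^d) = I(l₁,l₂,l₃,l₄)^n · l₁l₂l₃l₄. -/
def IsClebschS (n : ℕ) (Φ : MultilinearMap ℂ (fun _ : Fin 4 => V (3*n+1)) (V 4)) : Prop :=
  (∀ (v : Fin 4 → V (3*n+1)) (σ : Equiv.Perm (Fin 4)), Φ (v ∘ σ) = Φ v) ∧
  (∀ a b c d : Fin 3 → ℂ,
    Φ ![powV (3*n+1) a, powV (3*n+1) b, powV (3*n+1) c, powV (3*n+1) d]
      = (Icov a b c d) ^ n • prod4 a b c d)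

/-- Ψ is a Clebsch covariant of degree d = 3n+2: a symmetric quadrilinear map
V(d)⁴ → V(8) with Ψ(l₁^d,l₂^d,l₃^d,l₄^d) = I(l₁,l₂,l₃,l₄)^n · l₁²l₂²l₃²l₄². -/
def IsClebschT (n : ℕ) (Ψ : MultilinearMap ℂ (fun _ : Fin 4 => V (3*n+2)) (V 8)) : Prop :=
  (∀ (v : Fin 4 → V (3*n+2)) (σ : Equiv.Perm (Fin 4)), Ψ (v ∘ σ) = Ψ v) ∧
  (∀ a b c d : Fin 3 → ℂ,
    Ψ ![powV (3*n+2) a, powV (3*n+2) b, powV (3*n+2) c, powV (3*n+2) d]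
      = (Icov a b c d) ^ n • prod4sq a b c d)

/-- Membership in L_S = x₁^{2n+3}·V(n−2): a homogeneous form of degree 3n+1 lies in L_S
iff it is divisible by x₁^{2n+3}. -/
def memLS (n : ℕ) (h : V (3*n+1)) : Prop := (X 0 : MvP) ^ (2*n+3) ∣ (h : MvP)

/-- Membership in L_T = x₁^{2n+5}·V(n−3): a homogeneous form of degree 3n+2 lies in L_T
iff it is divisible by x₁^{2n+5}. -/
def memLT (n : ℕ) (h : V (3*n+2)) : Prop := (X 0 : MvP) ^ (2*n+5) ∣ (h : MvP)

/-- The Lagrange interpolation polynomial p_i^b of degree K−1 evaluated at c. -/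
def interp {K : ℕ} (b : Fin K → ℂ) (i : Fin K) (c : ℂ) : ℂ :=
  ∏ j ∈ Finset.univ.erase i, (c - b j) / (b i - b j)

/-- f(c) = Σᵢ p_i^b(c)·l_i^d − (cx₁+y)^d where y = λx₂+μx₃ and l_i = b_i x₁ + y. -/
def fc {K : ℕ} (d : ℕ) (b : Fin K → ℂ) (lam mu c : ℂ) : MvP :=
  ∑ i, C (interp b i c) * lin ![b i, lam, mu] ^ d - lin ![c, lam, mu] ^ d

/-- f(c) as an element of V(d). -/
def fcV {K : ℕ} (d : ℕ) (b : Fin K → ℂ) (lam mu c : ℂ) : V d :=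
  ∑ i, interp b i c • powV d ![b i, lam, mu] - powV d ![c, lam, mu]

/-- The bracket (l₁l₂l₃) over an arbitrary commutative ring. -/
def brR {R : Type*} [CommRing R] (a b c : Fin 3 → R) : R := Matrix.det (Matrix.of ![a, b, c])

/-- I(l₁,l₂,l₃,l₄) over an arbitrary commutative ring. -/
def IcovR {R : Type*} [CommRing R] (a b c d : Fin 3 → R) : R :=
  brR a b c * brR a b d * brR a c d * brR b c d

/-- The binomial coefficient polynomial X(X−1)⋯(X−m+1)/m! over ℂ. -/
def binomPoly (m : ℕ) : Polynomial ℂ :=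
  Polynomial.C ((m.factorial : ℂ))⁻¹ * ∏ i ∈ Finset.range m, (Polynomial.X - Polynomial.C (i : ℂ))

/-- The mod-p binomial coefficient polynomial X(X−1)⋯(X−m+1)/m!. -/
def binomPolyZMod (p m : ℕ) : Polynomial (ZMod p) :=
  Polynomial.C ((m.factorial : ZMod p))⁻¹ *
    ∏ i ∈ Finset.range m, (Polynomial.X - Polynomial.C (i : ZMod p))

/-- c·x₁ + λx₂ + μx₃ as an element of (ℂ[x₁,x₂,x₃])[c]. -/
def cLin (lam mu : ℂ) : Polynomial MvP :=
  Polynomial.X * Polynomial.C (X 0) + Polynomial.C (C lam * X 1 + C mu * X 2)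

/-- G_n = −24 Σ_{i<k<p} I(cx₁+y, m_i, m_k, m_p)^n·(cx₁+y)·m_i m_k m_p ∈ ℂ[c,x₁,x₂,x₃],
viewed as a polynomial in c with coefficients in ℂ[x₁,x₂,x₃]. -/
def Gpoly {N : ℕ} (m : Fin N → Fin 3 → ℂ) (lam mu : ℂ) (n : ℕ) : Polynomial MvP :=
  (-24 : Polynomial MvP) *
    ∑ i, ∑ k, ∑ p,
      if i < k ∧ k < p then
        Polynomial.map (MvPolynomial.C)
          ((IcovR ![Polynomial.X, Polynomial.C lam, Polynomial.C mu]
            (fun j => Polynomial.C (m i j)) (fun j => Polynomial.C (m k j))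
            (fun j => Polynomial.C (m p j))) ^ n)
        * cLin lam mu * Polynomial.C (lin (m i) * lin (m k) * lin (m p))
      else 0

/-- The nine linear forms m₁,…,m₉ (coefficient vectors). -/
def ms : Fin 9 → Fin 3 → ℂ :=
  ![![1, 3, 9], ![-10, 1, 4], ![8, 4, 6],
    ![1, 6, -10], ![4, -8, -10], ![-3, 7, -4],
    ![0, -3, 2], ![8, -4, -4], ![-10, 4, 6]]

set_option exponentiation.threshold 100000

namespace CC
/-- list operations written with recursors, for fast kernel reduction -/
def zw {α : Type} (f : α → α → α) (l : List α) : List α → List α :=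
  List.rec (motive := fun _ => List α → List α) (fun _ => [])
    (fun a _ ih m => List.rec (motive := fun _ => List α) [] (fun b m' _ => f a b :: ih m') m) l
def mp {α : Type} (f : α → α) (l : List α) : List α :=
  List.rec (motive := fun _ => List α) [] (fun a _ ih => f a :: ih) l

lemma zw_eq {α : Type} (f : α → α → α) (l m : List α) : zw f l m = List.zipWith f l m := by
  induction l generalizing m with
  | nil => rfl
  | cons a l ih =>
    cases m with
    | nil => rfl
    | cons b m => simp only [List.zipWith_cons_cons, ← ih m]; rfl

lemma mp_eq {α : Type} (f : α → α) (l : List α) : mp f l = List.map f l := by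
  induction l with
  | nil => rfl
  | cons a l ih => simp only [List.map_cons, ← ih]; rfl

abbrev T3 := List Nat
abbrev T4 := List T3
abbrev T5 := List T4
abbrev T6 := List T5
def NN : Nat := Nat.pow 2 73440
def z3 : T3 := [0,0,0]
def z4 : T4 := [z3,z3,z3]
def z5 : T5 := [z4,z4,z4]
def shr (x : T6) : T6 := z5 :: x
def shs (x : T6) : T6 := mp (fun x => z4 :: x) x
def sht (x : T6) : T6 := mp (mp (fun x => z3 :: x)) x
def shw (x : T6) : T6 := mp (mp (mp (fun x => 0 :: x))) x
def shp (x : T6) : T6 := mp (mp (mp (mp (fun z => Nat.shiftLeft z 8160)))) x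
def shq (x : T6) : T6 := mp (mp (mp (mp (fun z => Nat.shiftLeft z 168)))) x
def add6 : T6 → T6 → T6 := zw (zw (zw (zw Nat.add)))
def sub6 : T6 → T6 → T6 := zw (zw (zw (zw
  (fun a b => Nat.mod (Nat.add a (Nat.sub NN (Nat.mod b NN))) NN))))
def m1 (x : T6) : T6 := sub6 (add6 (add6 x (shs (sht (shp x)))) (shr (shw (shq x))))
  (add6 (add6 (shr (shp x)) (sht (shq x))) (shs (shw x)))
def m2 (x : T6) : T6 := sub6 (add6 (add6 x (shr (shq x))) (shs (shp x)))
  (add6 (add6 (shr (shp x)) (shs x)) (shq x))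
def m3 (x : T6) : T6 := sub6 (add6 (add6 x (sht (shp x))) (shw (shq x)))
  (add6 (add6 (sht (shq x)) (shw x)) (shp x))
def m4 (x : T6) : T6 := sub6 (add6 (add6 x (shs (sht x))) (shr (shw x)))
  (add6 (add6 (shs (shw x)) (shr x)) (sht x))
def mU (x : T6) : T6 := sub6 (m1 (m2 (m3 (m4 x)))) x
def x0 : T6 := [[[[1,0,0],z3,z3],z4,z4],z5,z5]
def itU (n : Nat) : T6 := Nat.rec x0 (fun _ x => mU x) n

abbrev R6 := MvPolynomial (Fin 6) ℤ
def f1 : R6 := (1 + X 1 * (X 2 * X 4) + X 0 * (X 3 * X 5)) - (X 0 * X 4 + X 2 * X 5 + X 1 * X 3)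
def f2 : R6 := (1 + X 0 * X 5 + X 1 * X 4) - (X 0 * X 4 + X 1 + X 5)
def f3 : R6 := (1 + X 2 * X 4 + X 3 * X 5) - (X 2 * X 5 + X 3 + X 4)
def f4 : R6 := (1 + X 1 * X 2 + X 0 * X 3) - (X 1 * X 3 + X 0 + X 2)
def UU : R6 := f1 * (f2 * (f3 * f4)) - 1

def slice {k : ℕ} (i : ℕ) (f : MvPolynomial (Fin (k+1)) ℤ) : MvPolynomial (Fin k) ℤ :=
  (finSuccEquiv ℤ k f).coeff i

def PZ : ℤ := 2^8160
def QZ : ℤ := 2^168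

def Rep2 (z : ℕ) (f : MvPolynomial (Fin 2) ℤ) : Prop :=
  PZ^9 ∣ (z : ℤ) - eval ![PZ, QZ] f

def RepL {α : Type} {k : ℕ} (R : α → MvPolynomial (Fin k) ℤ → Prop) (l : List α)
    (f : MvPolynomial (Fin (k+1)) ℤ) : Prop :=
  3 ≤ l.length ∧ ∀ i (h : i < l.length), R (l[i]) (slice i f)

lemma RepL.cons {α : Type} {k : ℕ} {R : α → MvPolynomial (Fin k) ℤ → Prop} {l : List α}
    {f : MvPolynomial (Fin (k+1)) ℤ} {z : α} (hz : R z 0) (h : RepL R l f) :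
    RepL R (z :: l) (X 0 * f) := by
  refine ⟨by have := h.1; simp only [List.length_cons]; omega, ?_⟩
  replace h := h.2
  intro i hi
  cases i with
  | zero => simpa [slice, finSuccEquiv_X_zero] using hz
  | succ i =>
    have := h i (by simpa using hi)
    simpa [slice, finSuccEquiv_X_zero] using this

lemma RepL.map {α : Type} {k : ℕ} {R : α → MvPolynomial (Fin k) ℤ → Prop} {l : List α}
    {f : MvPolynomial (Fin (k+1)) ℤ} {g : α → α} {j : Fin k}
    (hg : ∀ a f, R a f → R (g a) (X j * f)) (h : RepL R l f) :
    RepL R (mp g l) (X j.succ * f) := by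
  rw [mp_eq]
  refine ⟨by have := h.1; simpa using this, ?_⟩
  replace h := h.2
  intro i hi
  have := hg _ _ (h i (by simpa using hi))
  simpa [slice, finSuccEquiv_X_succ] using this

lemma RepL.zwa {α : Type} {k : ℕ} {R : α → MvPolynomial (Fin k) ℤ → Prop} {g : α → α → α}
    (hg : ∀ a f, R a f → ∀ b f', R b f' → R (g a b) (f + f')) :
    ∀ l f, RepL R l f → ∀ l' f', RepL R l' f' → RepL R (zw g l l') (f + f') := by
  intro l f h l' f' h'
  rw [zw_eq]
  refine ⟨by have := h.1; have := h'.1; simp; omega, ?_⟩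
  replace h := h.2
  replace h' := h'.2
  intro i hi
  have hi2 := hi
  rw [List.length_zipWith, lt_min_iff] at hi2
  have := hg _ _ (h i hi2.1) _ _ (h' i hi2.2)
  simpa [slice] using this

lemma RepL.zws {α : Type} {k : ℕ} {R : α → MvPolynomial (Fin k) ℤ → Prop} {g : α → α → α}
    (hg : ∀ a f, R a f → ∀ b f', R b f' → R (g a b) (f - f')) :
    ∀ l f, RepL R l f → ∀ l' f', RepL R l' f' → RepL R (zw g l l') (f - f') := by
  intro l f h l' f' h'
  rw [zw_eq]
  refine ⟨by have := h.1; have := h'.1; simp; omega, ?_⟩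
  replace h := h.2
  replace h' := h'.2
  intro i hi
  have hi2 := hi
  rw [List.length_zipWith, lt_min_iff] at hi2
  have := hg _ _ (h i hi2.1) _ _ (h' i hi2.2)
  simpa [slice] using this

abbrev Rep3 := RepL Rep2
abbrev Rep4 := RepL Rep3
abbrev Rep5 := RepL Rep4
abbrev Rep6 := RepL Rep5

lemma rep2_zero : Rep2 0 0 := by simp [Rep2]

lemma repL3_zero {α : Type} {k : ℕ} {R : α → MvPolynomial (Fin k) ℤ → Prop} {z : α} (hz : R z 0) :
    RepL R [z,z,z] 0 := by
  refine ⟨by simp, ?_⟩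
  intro i hi
  have : i = 0 ∨ i = 1 ∨ i = 2 := by simp at hi; omega
  rcases this with rfl | rfl | rfl <;> simpa [slice] using hz

lemma repL3_one {α : Type} {k : ℕ} {R : α → MvPolynomial (Fin k) ℤ → Prop} {a z : α}
    (ha : R a 1) (hz : R z 0) :
    RepL R [a,z,z] 1 := by
  refine ⟨by simp, ?_⟩
  intro i hi
  have : i = 0 ∨ i = 1 ∨ i = 2 := by simp at hi; omega
  rcases this with rfl | rfl | rfl
  · simpa [slice] using ha
  · simpa [slice, Polynomial.coeff_one] using hz
  · simpa [slice, Polynomial.coeff_one] using hz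

lemma rep3_z : Rep3 z3 0 := repL3_zero rep2_zero
lemma rep4_z : Rep4 z4 0 := repL3_zero rep3_z
lemma rep5_z : Rep5 z5 0 := repL3_zero rep4_z

lemma rep_x0 : Rep6 x0 1 :=
  repL3_one (repL3_one (repL3_one (repL3_one (by simp [Rep2]) rep2_zero) rep3_z) rep4_z) rep5_z

lemma rep_r {x : T6} {f : R6} (h : Rep6 x f) : Rep6 (shr x) (X 0 * f) := RepL.cons rep5_z h
lemma rep_s {x : T6} {f : R6} (h : Rep6 x f) : Rep6 (shs x) (X 1 * f) :=
  RepL.map (j := 0) (fun _ _ h => RepL.cons rep4_z h) h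
lemma rep_t {x : T6} {f : R6} (h : Rep6 x f) : Rep6 (sht x) (X 2 * f) :=
  RepL.map (j := 1) (fun _ _ h => RepL.map (j := 0) (fun _ _ h => RepL.cons rep3_z h) h) h
lemma rep_w {x : T6} {f : R6} (h : Rep6 x f) : Rep6 (shw x) (X 3 * f) :=
  RepL.map (j := 2) (fun _ _ h => RepL.map (j := 1) (fun _ _ h => RepL.map (j := 0)
    (fun _ _ h => RepL.cons rep2_zero h) h) h) h

lemma shl_cast (z e : ℕ) : ((Nat.shiftLeft z e : ℕ) : ℤ) = 2^e * z := by
  rw [show Nat.shiftLeft z e = z <<< e from rfl, Nat.shiftLeft_eq]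
  push_cast
  rw [mul_comm]

lemma rep2_p (z : ℕ) (f) (h : Rep2 z f) : Rep2 (Nat.shiftLeft z 8160) (X 0 * f) := by
  unfold Rep2 at *
  have e : ((Nat.shiftLeft z 8160 : ℕ) : ℤ) = PZ * z := shl_cast z 8160
  rw [e]
  simp only [map_mul, eval_X, Matrix.cons_val_zero]
  rw [← mul_sub]
  exact h.mul_left _

lemma rep2_q (z : ℕ) (f) (h : Rep2 z f) : Rep2 (Nat.shiftLeft z 168) (X 1 * f) := by
  unfold Rep2 at *
  have e : ((Nat.shiftLeft z 168 : ℕ) : ℤ) = QZ * z := shl_cast z 168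
  rw [e]
  simp only [map_mul, eval_X, Matrix.cons_val_one, Matrix.cons_val_zero]
  rw [← mul_sub]
  exact h.mul_left _

lemma rep_p {x : T6} {f : R6} (h : Rep6 x f) : Rep6 (shp x) (X 4 * f) :=
  RepL.map (j := 3) (fun _ _ h => RepL.map (j := 2) (fun _ _ h => RepL.map (j := 1)
    (fun _ _ h => RepL.map (j := 0) rep2_p h) h) h) h
lemma rep_q {x : T6} {f : R6} (h : Rep6 x f) : Rep6 (shq x) (X 5 * f) :=
  RepL.map (j := 4) (fun _ _ h => RepL.map (j := 3) (fun _ _ h => RepL.map (j := 2)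
    (fun _ _ h => RepL.map (j := 1) rep2_q h) h) h) h

lemma rep2_add : ∀ (a : ℕ) f, Rep2 a f → ∀ b f', Rep2 b f' → Rep2 (Nat.add a b) (f + f') := by
  intro a f h b f' h'
  unfold Rep2 at *
  have e : ((Nat.add a b : ℕ) : ℤ) = a + b := by
    rw [show Nat.add a b = a + b from rfl]; push_cast; rfl
  rw [e, map_add, add_sub_add_comm]
  exact dvd_add h h'

lemma NN_cast : ((NN : ℕ) : ℤ) = PZ^9 := by
  unfold NN PZ
  rw [show Nat.pow 2 73440 = 2 ^ 73440 from rfl, ← pow_mul]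
  exact Nat.cast_pow 2 _

lemma NN_pos : 0 < NN := by
  unfold NN
  exact Nat.pow_pos (by norm_num)

lemma rep2_sub : ∀ (a : ℕ) f, Rep2 a f → ∀ b f', Rep2 b f' →
    Rep2 (Nat.mod (Nat.add a (Nat.sub NN (Nat.mod b NN))) NN) (f - f') := by
  intro a f h b f' h'
  unfold Rep2 at *
  rw [← NN_cast] at *
  have e : ((Nat.mod (Nat.add a (Nat.sub NN (Nat.mod b NN))) NN : ℕ) : ℤ)
      = ((a : ℤ) + (NN - b % NN)) % NN := by
    rw [show Nat.mod (Nat.add a (Nat.sub NN (Nat.mod b NN))) NN = (a + (NN - b % NN)) % NN from rfl]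
    rw [Int.natCast_mod, Nat.cast_add, Nat.cast_sub (Nat.mod_lt _ NN_pos).le, Int.natCast_mod]
  rw [e, map_sub]
  obtain ⟨c, hc⟩ := h
  obtain ⟨d, hd⟩ := h'
  have e1 := Int.emod_add_mul_ediv ((a : ℤ) + (NN - b % NN)) NN
  have e2 := Int.emod_add_mul_ediv (b : ℤ) NN
  refine ⟨c - d + 1 + b / NN - ((a : ℤ) + (NN - b % NN)) / NN, ?_⟩
  linear_combination e1 + hc - hd - e2

lemma rep_add {x y : T6} {f g : R6} (h : Rep6 x f) (h' : Rep6 y g) : Rep6 (add6 x y) (f + g) :=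
  RepL.zwa (RepL.zwa (RepL.zwa (RepL.zwa rep2_add))) _ _ h _ _ h'
lemma rep_sub {x y : T6} {f g : R6} (h : Rep6 x f) (h' : Rep6 y g) : Rep6 (sub6 x y) (f - g) :=
  RepL.zws (RepL.zws (RepL.zws (RepL.zws rep2_sub))) _ _ h _ _ h'

lemma rep_m1 {x : T6} {f : R6} (h : Rep6 x f) : Rep6 (m1 x) (f1 * f) := by
  have := rep_sub (rep_add (rep_add h (rep_s (rep_t (rep_p h)))) (rep_r (rep_w (rep_q h))))
    (rep_add (rep_add (rep_r (rep_p h)) (rep_t (rep_q h))) (rep_s (rep_w h)))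
  refine Eq.mp (congrArg _ ?_) this
  unfold f1; ring
lemma rep_m2 {x : T6} {f : R6} (h : Rep6 x f) : Rep6 (m2 x) (f2 * f) := by
  have := rep_sub (rep_add (rep_add h (rep_r (rep_q h))) (rep_s (rep_p h)))
    (rep_add (rep_add (rep_r (rep_p h)) (rep_s h)) (rep_q h))
  refine Eq.mp (congrArg _ ?_) this
  unfold f2; ring
lemma rep_m3 {x : T6} {f : R6} (h : Rep6 x f) : Rep6 (m3 x) (f3 * f) := by
  have := rep_sub (rep_add (rep_add h (rep_t (rep_p h))) (rep_w (rep_q h)))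
    (rep_add (rep_add (rep_t (rep_q h)) (rep_w h)) (rep_p h))
  refine Eq.mp (congrArg _ ?_) this
  unfold f3; ring
lemma rep_m4 {x : T6} {f : R6} (h : Rep6 x f) : Rep6 (m4 x) (f4 * f) := by
  have := rep_sub (rep_add (rep_add h (rep_s (rep_t h))) (rep_r (rep_w h)))
    (rep_add (rep_add (rep_s (rep_w h)) (rep_r h)) (rep_t h))
  refine Eq.mp (congrArg _ ?_) this
  unfold f4; ring
lemma rep_U (n : ℕ) : Rep6 (itU n) (UU ^ n) := by
  induction n with
  | zero => rw [pow_zero]; exact rep_x0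
  | succ n ih =>
    have := rep_sub (rep_m1 (rep_m2 (rep_m3 (rep_m4 ih)))) ih
    rw [show itU (n+1) = mU (itU n) from rfl]
    refine Eq.mp (congrArg _ ?_) this
    unfold UU; ring

-- digits
def offs (B H : ℕ) (m : ℕ) : ℕ := Nat.rec 0 (fun _ x => H + B * x) m

lemma digit_aux (B H : ℕ) (hB : B = 2 * H) (hH : 0 < H) (k : ℕ) : ∀ (m : ℕ) (z : ℤ) (f : Polynomial ℤ),
    k < m → (∀ i, |f.coeff i| < H) → (B : ℤ)^m ∣ z - f.eval (B : ℤ) →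
    (z + offs B H m) / (B:ℤ)^k % B = f.coeff k + H := by
  induction k with
  | zero =>
    intro m z f hm hf hz
    obtain ⟨m, rfl⟩ : ∃ m', m = m' + 1 := ⟨m - 1, by omega⟩
    obtain ⟨c, hc⟩ := hz
    have ho : (offs B H (m+1) : ℤ) = H + B * offs B H m := by
      rw [show offs B H (m+1) = H + B * offs B H m from rfl]; push_cast; rfl
    have hfe : f.eval (B:ℤ) = B * f.divX.eval (B:ℤ) + f.coeff 0 := by
      conv_lhs => rw [← Polynomial.divX_mul_X_add f]
      simp [mul_comm]
    have h0 := abs_lt.mp (hf 0)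
    have : z + offs B H (m+1) = (f.coeff 0 + H) + B * (f.divX.eval (B:ℤ) + B^m * c + offs B H m) := by
      rw [ho]; rw [hfe] at hc; linear_combination hc
    rw [pow_zero, Int.ediv_one, this, Int.add_mul_emod_self_left]
    apply Int.emod_eq_of_lt <;> [skip; subst hB] <;> push_cast <;> linarith [h0.1, h0.2]
  | succ k ih =>
    intro m z f hm hf hz
    obtain ⟨m, rfl⟩ : ∃ m', m = m' + 1 := ⟨m - 1, by omega⟩
    obtain ⟨c, hc⟩ := hz
    have ho : (offs B H (m+1) : ℤ) = H + B * offs B H m := by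
      rw [show offs B H (m+1) = H + B * offs B H m from rfl]; push_cast; rfl
    have hfe : f.eval (B:ℤ) = B * f.divX.eval (B:ℤ) + f.coeff 0 := by
      conv_lhs => rw [← Polynomial.divX_mul_X_add f]
      simp [mul_comm]
    have h0 := abs_lt.mp (hf 0)
    have : z + offs B H (m+1) = (f.coeff 0 + H) + B * (f.divX.eval (B:ℤ) + B^m * c + offs B H m) := by
      rw [ho]; rw [hfe] at hc; linear_combination hc
    have hB0 : (B:ℤ) ≠ 0 := by subst hB; positivity
    rw [pow_succ', ← Int.ediv_ediv_of_nonneg (by positivity), this, Int.add_mul_ediv_left _ _ hB0,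
      Int.ediv_eq_zero_of_lt (a := f.coeff 0 + H) (b := B) (by linarith [h0.1]) (by subst hB; push_cast; linarith [h0.2]), zero_add]
    rw [ih m _ f.divX (by omega) (fun i => by simpa using hf (i+1)) ⟨c, by ring⟩]
    simp

def Maj {σ : Type} (f g : MvPolynomial σ ℤ) : Prop := ∀ m, |coeff m f| ≤ coeff m g

lemma Maj.nonneg {σ : Type} {f g : MvPolynomial σ ℤ} (h : Maj f g) (m) : 0 ≤ coeff m g :=
  (abs_nonneg _).trans (h m)
lemma Maj.self {σ : Type} {f g : MvPolynomial σ ℤ} (h : Maj f g) : Maj g g :=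
  fun m => (abs_of_nonneg (h.nonneg m)).le
lemma Maj.add {σ : Type} {f g f' g' : MvPolynomial σ ℤ} (h : Maj f g) (h' : Maj f' g') :
    Maj (f + f') (g + g') := fun m => by
  rw [coeff_add, coeff_add]; exact (abs_add_le _ _).trans (add_le_add (h m) (h' m))
lemma Maj.sub {σ : Type} {f g f' g' : MvPolynomial σ ℤ} (h : Maj f g) (h' : Maj f' g') :
    Maj (f - f') (g + g') := fun m => by
  rw [coeff_sub, coeff_add]; exact (abs_sub _ _).trans (add_le_add (h m) (h' m))
lemma Maj.mul {σ : Type} {f g f' g' : MvPolynomial σ ℤ} (h : Maj f g) (h' : Maj f' g') :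
    Maj (f * f') (g * g') := fun m => by
  classical
  rw [coeff_mul, coeff_mul]
  refine (Finset.abs_sum_le_sum_abs _ _).trans (Finset.sum_le_sum fun x _ => ?_)
  rw [abs_mul]
  exact mul_le_mul (h _) (h' _) (abs_nonneg _) (h.nonneg _)
lemma Maj.one {σ : Type} : Maj (1 : MvPolynomial σ ℤ) 1 := fun m => by
  classical
  rw [coeff_one]; split_ifs <;> simp
lemma Maj.X {σ : Type} (i : σ) : Maj (X i : MvPolynomial σ ℤ) (X i) := fun m => by
  classical
  rw [coeff_X]; split_ifs <;> simp
lemma Maj.pow {σ : Type} {f g : MvPolynomial σ ℤ} (h : Maj f g) (n : ℕ) : Maj (f ^ n) (g ^ n) := by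
  induction n with
  | zero => simpa using Maj.one
  | succ n ih => rw [pow_succ, pow_succ]; exact ih.mul h

lemma Maj.slice {k : ℕ} {f g : MvPolynomial (Fin (k+1)) ℤ} (h : Maj f g) (i : ℕ) :
    Maj (slice i f) (slice i g) := fun m => by
  unfold CC.slice
  rw [finSuccEquiv_coeff_coeff, finSuccEquiv_coeff_coeff]; exact h _

lemma Maj.evl {σ : Type} {f g : MvPolynomial σ ℤ} (h : Maj f g) (ρ : σ → ℤ)
    (hρ : ∀ i, 0 ≤ ρ i) : |eval ρ f| ≤ eval ρ g := by
  classical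
  have key : ∀ u : MvPolynomial σ ℤ, ∀ s : Finset (σ →₀ ℕ), u.support ⊆ s →
      MvPolynomial.eval ρ u = ∑ d ∈ s, coeff d u * d.prod fun i k => ρ i ^ k := by
    intro u s hs
    rw [eval_eq]
    apply Finset.sum_subset hs
    intro d _ hd
    rw [notMem_support_iff.mp hd, zero_mul]
  rw [key f (f.support ∪ g.support) Finset.subset_union_left,
    key g (f.support ∪ g.support) Finset.subset_union_right]
  refine (Finset.abs_sum_le_sum_abs _ _).trans (Finset.sum_le_sum fun d _ => ?_)
  have : 0 ≤ d.prod fun i k => ρ i ^ k := Finset.prod_nonneg fun i _ => pow_nonneg (hρ i) _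
  rw [abs_mul, abs_of_nonneg this]
  exact mul_le_mul_of_nonneg_right (h d) this

lemma Maj.slice_eval {k : ℕ} {g : MvPolynomial (Fin (k+1)) ℤ} (h : Maj g g) (i : ℕ)
    (ρ : Fin k → ℤ) (hρ : ∀ i, 0 ≤ ρ i) :
    MvPolynomial.eval ρ (CC.slice i g) ≤ MvPolynomial.eval (Fin.cons 1 ρ : Fin (k+1) → ℤ) g := by
  rw [eval_eq_eval_mv_eval', Polynomial.eval_eq_sum, Polynomial.sum]
  simp only [one_pow, mul_one]
  have nn : ∀ j, 0 ≤ (Polynomial.map (MvPolynomial.eval ρ) (finSuccEquiv ℤ k g)).coeff j := by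
    intro j
    rw [Polynomial.coeff_map]
    exact (abs_nonneg _).trans ((h.slice j).evl ρ hρ)
  have e : MvPolynomial.eval ρ (CC.slice i g) =
      (Polynomial.map (MvPolynomial.eval ρ) (finSuccEquiv ℤ k g)).coeff i := by
    rw [Polynomial.coeff_map]; rfl
  rw [e]
  by_cases hi : i ∈ (Polynomial.map (MvPolynomial.eval ρ) (finSuccEquiv ℤ k g)).support
  · exact Finset.single_le_sum (f := fun j => (Polynomial.map (MvPolynomial.eval ρ) (finSuccEquiv ℤ k g)).coeff j)
      (fun j _ => nn j) hi
  · rw [Polynomial.notMem_support_iff.mp hi]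
    exact Finset.sum_nonneg fun j _ => nn j

lemma coeff_slice {k : ℕ} (m : Fin (k+1) →₀ ℕ) (f : MvPolynomial (Fin (k+1)) ℤ) :
    coeff m f = coeff m.tail (slice (m 0) f) := by
  unfold slice
  rw [finSuccEquiv_coeff_coeff, Finsupp.cons_tail]

lemma eval_fin0 (ρ : Fin 0 → ℤ) (m) (f : MvPolynomial (Fin 0) ℤ) : eval ρ f = coeff m f := by
  rw [eq_C_of_isEmpty f, eval_C, coeff_C]
  rw [if_pos (Subsingleton.elim _ _)]

lemma Maj.coeff_le {k : ℕ} {g : MvPolynomial (Fin k) ℤ} (h : Maj g g) (m : Fin k →₀ ℕ) :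
    coeff m g ≤ MvPolynomial.eval (fun _ => 1) g := by
  induction k with
  | zero => rw [eval_fin0 _ m]
  | succ k ih =>
    rw [coeff_slice]
    refine (ih (h.slice _) _).trans ((h.slice_eval (m 0) (fun _ => 1) (by simp)).trans (le_of_eq ?_))
    congr 2
    ext i
    refine Fin.cases rfl (fun _ => rfl) i

def g1 : R6 := (1 + X 1 * (X 2 * X 4) + X 0 * (X 3 * X 5)) + (X 0 * X 4 + X 2 * X 5 + X 1 * X 3)
def g2 : R6 := (1 + X 0 * X 5 + X 1 * X 4) + (X 0 * X 4 + X 1 + X 5)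
def g3 : R6 := (1 + X 2 * X 4 + X 3 * X 5) + (X 2 * X 5 + X 3 + X 4)
def g4 : R6 := (1 + X 1 * X 2 + X 0 * X 3) + (X 1 * X 3 + X 0 + X 2)
def GG : R6 := g1 * (g2 * (g3 * g4)) + 1

lemma maj1 : Maj f1 g1 := ((Maj.one.add ((Maj.X _).mul ((Maj.X _).mul (Maj.X _)))).add
  ((Maj.X _).mul ((Maj.X _).mul (Maj.X _)))).sub ((((Maj.X _).mul (Maj.X _)).add
    ((Maj.X _).mul (Maj.X _))).add ((Maj.X _).mul (Maj.X _)))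
lemma maj2 : Maj f2 g2 := ((Maj.one.add ((Maj.X _).mul (Maj.X _))).add
  ((Maj.X _).mul (Maj.X _))).sub ((((Maj.X _).mul (Maj.X _)).add (Maj.X _)).add (Maj.X _))
lemma maj3 : Maj f3 g3 := ((Maj.one.add ((Maj.X _).mul (Maj.X _))).add
  ((Maj.X _).mul (Maj.X _))).sub ((((Maj.X _).mul (Maj.X _)).add (Maj.X _)).add (Maj.X _))
lemma maj4 : Maj f4 g4 := ((Maj.one.add ((Maj.X _).mul (Maj.X _))).add
  ((Maj.X _).mul (Maj.X _))).sub ((((Maj.X _).mul (Maj.X _)).add (Maj.X _)).add (Maj.X _))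
lemma majU : Maj UU GG := (maj1.mul (maj2.mul (maj3.mul maj4))).sub Maj.one

lemma evalG (q : ℤ) : eval ![1,1,1,1,1,q] GG = (4+2*q)*((4+2*q)*((4+2*q)*6))+1 := by
  simp [GG, g1, g2, g3, g4]
  ring

def PN : ℕ := Nat.pow 2 8160
def HP : ℕ := Nat.pow 2 8159
def QN : ℕ := Nat.pow 2 168
def HQ : ℕ := Nat.pow 2 167
def OP : ℕ := offs PN HP 9
def OQ : ℕ := offs QN HQ 9

def dgv (z k l : ℕ) : ℕ :=
  Nat.mod (Nat.div (Nat.add (Nat.mod (Nat.div (Nat.add z OP) (Nat.pow PN k)) PN) OQ) (Nat.pow QN l)) QN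

lemma PN_cast : (PN : ℤ) = PZ := Nat.cast_pow 2 _
lemma QN_cast : (QN : ℤ) = QZ := Nat.cast_pow 2 _

lemma PN_two : PN = 2 * HP := pow_succ' 2 8159
lemma QN_two : QN = 2 * HQ := pow_succ' 2 167
lemma HP_pos : 0 < HP := Nat.pow_pos (by norm_num)
lemma HQ_pos : 0 < HQ := Nat.pow_pos (by norm_num)
lemma HP_dvd : QZ ^ 9 ∣ (HP : ℤ) := by
  have : (HP : ℤ) = 2 ^ 8159 := Nat.cast_pow 2 _
  rw [this, QZ, ← pow_mul]
  exact pow_dvd_pow _ (by norm_num)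

lemma dgv_spec (z : ℕ) (f : MvPolynomial (Fin 2) ℤ) (h : Rep2 z f)
    (h1 : ∀ k, |eval (fun _ => QZ) (slice k f)| < HP)
    (h2 : ∀ k l, |coeff 0 (slice l (slice k f))| < HQ) (k l : ℕ) (hk : k < 9) (hl : l < 9) :
    coeff 0 (slice l (slice k f)) = (dgv z k l : ℤ) - HQ := by
  have a1 := digit_aux PN HP PN_two HP_pos k 9 z
    (Polynomial.map (eval (fun _ : Fin 1 => QZ)) (finSuccEquiv ℤ 1 f)) hk
    (fun i => by rw [Polynomial.coeff_map]; exact h1 i)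
    (by
      rw [PN_cast]
      unfold Rep2 at h
      convert h using 2
      rw [← eval_eq_eval_mv_eval']
      congr 2
      ext i
      fin_cases i <;> rfl)
  rw [Polynomial.coeff_map] at a1
  set y : ℕ := (z + OP) / PN ^ k % PN with hy
  have a1' : (y : ℤ) = eval (fun _ => QZ) (slice k f) + HP := by
    rw [hy]; push_cast; exact a1
  have a2 := digit_aux QN HQ QN_two HQ_pos l 9 y
    (Polynomial.map (eval (Fin.elim0 : Fin 0 → ℤ)) (finSuccEquiv ℤ 0 (slice k f))) hl
    (fun i => by rw [Polynomial.coeff_map, eval_fin0 _ 0]; exact h2 k i)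
    (by
      rw [QN_cast, ← eval_eq_eval_mv_eval', a1']
      have : (Fin.cons QZ (Fin.elim0 : Fin 0 → ℤ) : Fin 1 → ℤ) = fun _ => QZ := by
        ext i; fin_cases i; rfl
      rw [this, add_sub_cancel_left]
      exact HP_dvd)
  rw [Polynomial.coeff_map, eval_fin0 _ 0] at a2
  have e : ((dgv z k l : ℕ) : ℤ) = (y + (offs QN HQ 9 : ℕ)) / (QN : ℤ)^l % QN := by
    have : dgv z k l = (y + OQ) / QN ^ l % QN := rfl
    rw [this]; push_cast; rfl
  rw [e, a2]
  exact (add_sub_cancel_right _ _).symm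

def nt {α : Type} (d : α) (l : List α) (i : ℕ) : α :=
  List.rec (motive := fun _ => ℕ → α) (fun _ => d)
    (fun a _ ih i => Nat.rec (motive := fun _ => α) a (fun i _ => ih i) i) l i

lemma nt_eq {α : Type} (d : α) (l : List α) (i : ℕ) (h : i < l.length) : nt d l i = l[i] := by
  induction l generalizing i with
  | nil => simp at h
  | cons a l ih =>
    cases i with
    | zero => rfl
    | succ i =>
      have := ih i (by simpa using h)
      exact this

def look (L : T6) (r s t w : ℕ) : ℕ := nt 0 (nt z3 (nt z4 (nt z5 L r) s) t) w

lemma nt_rep {α : Type} {k : ℕ} {R : α → MvPolynomial (Fin k) ℤ → Prop} {l : List α} {d : α}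
    {f : MvPolynomial (Fin (k+1)) ℤ} (h : RepL R l f) (i : ℕ) (hi : i < 3) :
    R (nt d l i) (slice i f) := by
  rw [nt_eq _ _ _ (lt_of_lt_of_le hi h.1)]
  exact h.2 i _

lemma cons_eq (q : ℤ) : (Fin.cons 1 (Fin.cons 1 (Fin.cons 1 (Fin.cons 1 (Fin.cons 1 (fun _ : Fin 1 => q) :
      Fin 2 → ℤ) : Fin 3 → ℤ) : Fin 4 → ℤ) : Fin 5 → ℤ) : Fin 6 → ℤ) = ![1,1,1,1,1,q] := by
  have h : (fun _ : Fin 1 => q) = ![q] := by ext i; simp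
  rw [h]
  rfl

lemma numP (j : ℕ) (hj : j ≤ 16) :
    ((4+2*QZ)*((4+2*QZ)*((4+2*QZ)*6))+1) ^ j < (HP : ℤ) := by
  have h1 : (1:ℤ) ≤ ((4+2*QZ)*((4+2*QZ)*((4+2*QZ)*6))+1) := by unfold QZ; norm_num
  refine (pow_le_pow_right₀ h1 hj).trans_lt ?_
  have h2 : ((4+2*QZ)*((4+2*QZ)*((4+2*QZ)*6))+1) ^ 4 ≤ 2^(2039) := by unfold QZ; norm_num
  rw [show 16 = 4 * 4 from rfl, pow_mul]
  refine (pow_le_pow_left₀ (by positivity) h2 4).trans_lt ?_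
  have : (HP : ℤ) = 2 ^ 8159 := Nat.cast_pow 2 _
  rw [this, ← pow_mul]
  exact pow_lt_pow_right₀ (by norm_num) (by norm_num)

lemma numQ (j : ℕ) (hj : j ≤ 16) :
    ((4+2*1)*((4+2*1)*((4+2*1)*6))+1 : ℤ) ^ j < (HQ : ℤ) := by
  refine (pow_le_pow_right₀ (by norm_num) hj).trans_lt ?_
  have : (HQ : ℤ) = 2 ^ 167 := Nat.cast_pow 2 _
  rw [this]
  norm_num

lemma QZ_nonneg : 0 ≤ QZ := by unfold QZ; positivity

lemma coeff_slice6 (m : Fin 6 →₀ ℕ) (f : R6) :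
    coeff m f = coeff 0 (slice (m 5) (slice (m 4) (slice (m 3) (slice (m 2) (slice (m 1)
      (slice (m 0) f)))))) := by
  rw [coeff_slice, coeff_slice, coeff_slice, coeff_slice, coeff_slice, coeff_slice]
  rw [Subsingleton.elim (Finsupp.tail _ : Fin 0 →₀ ℕ) 0]
  rfl

/-- coefficient extraction -/
lemma coeff_U (j : ℕ) (hj : j ≤ 16) (m : Fin 6 →₀ ℕ) (h0 : m 0 < 3) (h1 : m 1 < 3) (h2 : m 2 < 3)
    (h3 : m 3 < 3) (h4 : m 4 < 9) (h5 : m 5 < 9) :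
    coeff m (UU ^ j) = (dgv (look (itU j) (m 0) (m 1) (m 2) (m 3)) (m 4) (m 5) : ℤ) - HQ := by
  have hM := majU.pow j
  have hm : ∀ m, |coeff m (UU ^ j)| < HQ := by
    intro m
    refine ((hM m).trans (hM.self.coeff_le m)).trans_lt ?_
    rw [map_pow, show (fun _ : Fin 6 => (1:ℤ)) = ![1,1,1,1,1,1] from by ext i; fin_cases i <;> rfl,
      evalG]
    exact numQ j hj
  have r3 := nt_rep (d := 0) (nt_rep (d := z3) (nt_rep (d := z4) (nt_rep (d := z5) (rep_U j) (m 0) h0)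
    (m 1) h1) (m 2) h2) (m 3) h3
  have e := dgv_spec _ _ r3 ?_ ?_ (m 4) (m 5) h4 h5
  · rw [look, ← e, coeff_slice6]
  · intro k
    refine (((((((hM.slice _).slice _).slice _).slice _).slice _)).evl _ (fun _ => QZ_nonneg)).trans_lt ?_
    have s := hM.self
    have nn : ∀ i : Fin 1, 0 ≤ (fun _ : Fin 1 => QZ) i := fun _ => QZ_nonneg
    have cc : ∀ {k : ℕ} (ρ : Fin k → ℤ), (∀ i, 0 ≤ ρ i) →
        ∀ i, 0 ≤ (Fin.cons 1 ρ : Fin (k+1) → ℤ) i := by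
      intro k ρ h i
      refine Fin.cases ?_ ?_ i
      · simp
      · intro i; simpa using h i
    refine (((((s.slice _).slice _).slice _).slice _).slice_eval _ _ nn).trans_lt ?_
    refine ((((s.slice _).slice _).slice _).slice_eval _ _ (cc _ nn)).trans_lt ?_
    refine (((s.slice _).slice _).slice_eval _ _ (cc _ (cc _ nn))).trans_lt ?_
    refine ((s.slice _).slice_eval _ _ (cc _ (cc _ (cc _ nn)))).trans_lt ?_
    refine (s.slice_eval _ _ (cc _ (cc _ (cc _ (cc _ nn))))).trans_lt ?_
    rw [cons_eq, map_pow, evalG]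
    exact numP j hj
  · intro k l
    have := hm (Finsupp.cons (m 0) (Finsupp.cons (m 1) (Finsupp.cons (m 2) (Finsupp.cons (m 3)
      (Finsupp.cons k (Finsupp.cons l 0))))))
    unfold slice
    simp only [finSuccEquiv_coeff_coeff]
    exact this

structure Tm where
  c : ℕ
  r : ℕ
  s : ℕ
  t : ℕ
  w : ℕ
  p : ℕ
  q : ℕ
  x : ℕ
  y : ℕ
  z : ℕ

def tmul (a b : Tm) : Tm := ⟨Nat.mul a.c b.c, Nat.add a.r b.r, Nat.add a.s b.s, Nat.add a.t b.t,
  Nat.add a.w b.w, Nat.add a.p b.p, Nat.add a.q b.q, Nat.add a.x b.x, Nat.add a.y b.y, Nat.add a.z b.z⟩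
def tdbl (a : Tm) : Tm := { a with c := Nat.mul 2 a.c }

def sq6 (a b c : Tm) : List Tm :=
  [tmul a a, tmul b b, tmul c c, tdbl (tmul a b), tdbl (tmul a c), tdbl (tmul b c)]

def lmul (l m : List Tm) : List Tm := l.flatMap fun a => m.map (tmul a)

def tms : List Tm :=
  lmul (lmul (lmul
    (sq6 ⟨1,0,0,0,0,0,0,1,0,0⟩ ⟨1,0,0,0,0,1,0,0,1,0⟩ ⟨1,0,0,0,0,0,1,0,0,1⟩)
    (sq6 ⟨1,1,0,0,0,0,0,1,0,0⟩ ⟨1,0,0,0,0,0,0,0,1,0⟩ ⟨1,0,1,0,0,0,0,0,0,1⟩))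
    (sq6 ⟨1,0,0,1,0,0,0,1,0,0⟩ ⟨1,0,0,0,1,0,0,0,1,0⟩ ⟨1,0,0,0,0,0,0,0,0,1⟩))
    (sq6 ⟨1,0,0,0,0,0,0,1,0,0⟩ ⟨1,0,0,0,0,0,0,0,1,0⟩ ⟨1,0,0,0,0,0,0,0,0,1⟩)

def isM (M0 M1 M2 : ℕ) (τ : Tm) : Bool :=
  Bool.and (Nat.beq τ.y M1) (Bool.and (Nat.beq τ.z M2) (Nat.beq τ.x M0))

def fits (M1 M2 : ℕ) (τ : Tm) : Bool :=
  Bool.and (Nat.ble τ.r 2) (Bool.and (Nat.ble τ.s 2) (Bool.and (Nat.ble τ.t 2)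
    (Bool.and (Nat.ble τ.w 2) (Bool.and (Nat.ble τ.p M1) (Nat.ble τ.q M2)))))

def tmM (M0 M1 M2 : ℕ) : List Tm := tms.filter (isM M0 M1 M2)

def dterm (L : T6) (M1 M2 : ℕ) (τ : Tm) : ℕ :=
  Nat.mul τ.c (dgv (look L (Nat.sub 2 τ.r) (Nat.sub 2 τ.s) (Nat.sub 2 τ.t) (Nat.sub 2 τ.w))
      (Nat.sub M1 τ.p) (Nat.sub M2 τ.q))

def kapA (L : T6) (M1 M2 : ℕ) (l : List Tm) : ℕ :=
  List.rec 0 (fun τ _ ih => Nat.add (dterm L M1 M2 τ) ih) l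
def kapB (l : List Tm) : ℕ := List.rec 0 (fun τ _ ih => Nat.add τ.c ih) l
def kapL (M1 M2 : ℕ) (l : List Tm) (j : ℕ) : ℤ :=
  Int.subNatNat (kapA (itU j) M1 M2 l) (Nat.mul HQ (kapB l))

def kaps (M1 M2 : ℕ) (l : List Tm) : List ℤ :=
  [kapL M1 M2 l 0, kapL M1 M2 l 1, kapL M1 M2 l 2, kapL M1 M2 l 3, kapL M1 M2 l 4, kapL M1 M2 l 5,
   kapL M1 M2 l 6, kapL M1 M2 l 7, kapL M1 M2 l 8, kapL M1 M2 l 9, kapL M1 M2 l 10, kapL M1 M2 l 11,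
   kapL M1 M2 l 12, kapL M1 M2 l 13, kapL M1 M2 l 14, kapL M1 M2 l 15, kapL M1 M2 l 16]

def hd (l : List ℤ) : ℤ := List.rec 0 (fun a _ _ => a) l
def shN (l : List ℤ) : List ℤ := List.rec [] (fun a t ih => Int.add a (hd t) :: ih) l
def ipos (a : ℤ) : Bool := Int.rec (fun n => Nat.ble 1 n) (fun _ => false) a
def inn (a : ℤ) : Bool := Int.rec (fun _ => true) (fun _ => false) a
def inp (a : ℤ) : Bool := Int.rec (fun n => Nat.beq n 0) (fun _ => true) a
def allB (f : ℤ → Bool) (l : List ℤ) : Bool := List.rec true (fun a _ ih => Bool.and (f a) ih) l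
def good (fuel : ℕ) : List ℤ → Bool :=
  Nat.rec (motive := fun _ => List ℤ → Bool) (fun _ => false) (fun _ ih l =>
    Bool.or (Bool.and (ipos (hd l)) (allB inn l))
      (Bool.or (Bool.and (Bool.not (inn (hd l))) (allB inp l))
        (Bool.and (Bool.not (Bool.and (inn (hd l)) (inp (hd l)))) (ih (shN l))))) fuel
def shNk (k : ℕ) (l : List ℤ) : List ℤ := Nat.rec l (fun _ x => shN x) k

def chk (M0 M1 M2 : ℕ) : Bool := good 200 (shNk 21 (kaps M1 M2 (tmM M0 M1 M2)))

def chkAll : Bool := (List.range 9).all fun a => (List.range 9).all fun b =>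
  Bool.or (Nat.blt 8 (Nat.add a b)) (chk (Nat.sub 8 (Nat.add a b)) a b)

theorem chkAll_true : chkAll = true := by decide +kernel

/-- Newton form evaluation -/
def nwi (i : ℕ) (l : List ℤ) (m : ℕ) : ℤ :=
  match l with
  | [] => 0
  | a :: l => a * (m.choose i : ℤ) + nwi (i+1) l m

lemma nwi_shN (l : List ℤ) : ∀ (i m : ℕ),
    nwi (i+1) (shN l) m + hd l * (m.choose i : ℤ) = nwi i l m + nwi (i+1) l m := by
  induction l with
  | nil => intro i m; simp [nwi, shN, hd]
  | cons a l ih =>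
    intro i m
    have e : shN (a :: l) = (a + hd l) :: shN l := rfl
    have e2 : hd (a :: l) = a := rfl
    rw [e, e2]
    have := ih (i+1) m
    simp only [nwi]
    linear_combination this

lemma nwi_succ (l : List ℤ) : ∀ (i m : ℕ),
    nwi (i+1) l (m+1) = nwi i l m + nwi (i+1) l m := by
  induction l with
  | nil => intro i m; simp [nwi]
  | cons a l ih =>
    intro i m
    simp only [nwi, ih, Nat.choose_succ_succ]
    push_cast
    ring

lemma nw_shN (l : List ℤ) (m : ℕ) : nwi 0 (shN l) m = nwi 0 l (m+1) := by
  cases l with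
  | nil => simp [nwi, shN]
  | cons a l =>
    have e : shN (a :: l) = (a + hd l) :: shN l := rfl
    rw [e]
    simp only [nwi, Nat.choose_zero_right]
    have h1 := nwi_shN l 0 m
    have h2 := nwi_succ l 0 m
    simp only [Nat.choose_zero_right] at h1
    linear_combination h1 - h2

lemma nw_zero (l : List ℤ) : nwi 0 l 0 = hd l := by
  have h : ∀ (l : List ℤ) (i : ℕ), nwi (i+1) l 0 = 0 := by
    intro l
    induction l with
    | nil => intro i; rfl
    | cons a l ih => intro i; simp [nwi, ih]
  cases l with
  | nil => rfl
  | cons a l => simp [nwi, h, hd]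

lemma ipos_iff (a : ℤ) : ipos a = true → 0 < a := by
  cases a with
  | ofNat n => intro h; have := Nat.le_of_ble_eq_true h; simp; omega
  | negSucc n => intro h; cases h
lemma inn_iff (a : ℤ) : inn a = true ↔ 0 ≤ a := by
  cases a with
  | ofNat n => simp [inn]
  | negSucc n => constructor
                 · intro h; cases h
                 · intro h; exact absurd h (by simp)
lemma inp_iff (a : ℤ) : inp a = true ↔ a ≤ 0 := by
  cases a with
  | ofNat n =>
    constructor
    · intro h; have := Nat.eq_of_beq_eq_true h; simp [this]
    · intro h
      have : n = 0 := by simpa using h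
      subst this; rfl
  | negSucc n => constructor
                 · intro _; exact (Int.negSucc_lt_zero n).le
                 · intro _; rfl

lemma nwi_nonneg (l : List ℤ) : ∀ i m, allB inn l = true → 0 ≤ nwi i l m := by
  induction l with
  | nil => intro i m _; exact le_refl _
  | cons a l ih =>
    intro i m h
    have h' : (inn a && allB inn l) = true := h
    rw [Bool.and_eq_true] at h'
    have := (inn_iff a).1 h'.1
    have := ih (i+1) m h'.2
    simp only [nwi]; positivity

lemma nwi_nonpos (l : List ℤ) : ∀ i m, allB inp l = true → nwi i l m ≤ 0 := by
  induction l with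
  | nil => intro i m _; exact le_refl _
  | cons a l ih =>
    intro i m h
    have h' : (inp a && allB inp l) = true := h
    rw [Bool.and_eq_true] at h'
    have h1 := (inp_iff a).1 h'.1
    have h2 := ih (i+1) m h'.2
    simp only [nwi]
    have := mul_nonpos_of_nonpos_of_nonneg h1 (Int.natCast_nonneg (m.choose i))
    linarith

lemma good_spec (fuel : ℕ) : ∀ l, good fuel l = true → ∀ m, nwi 0 l m ≠ 0 := by
  induction fuel with
  | zero => intro l h; cases h
  | succ f ih =>
    intro l h m
    have h' : ((ipos (hd l) && allB inn l) || ((!(inn (hd l)) && allB inp l) ||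
      (!(inn (hd l) && inp (hd l)) && good f (shN l)))) = true := h
    rw [Bool.or_eq_true, Bool.or_eq_true, Bool.and_eq_true, Bool.and_eq_true, Bool.and_eq_true] at h'
    rcases h' with ⟨h1, h2⟩ | ⟨h1, h2⟩ | ⟨h1, h2⟩
    · cases l with
      | nil => exact absurd (ipos_iff _ h1) (by simp [hd])
      | cons a l =>
        have h3 : (inn a && allB inn l) = true := h2
        rw [Bool.and_eq_true] at h3
        have h4 : 0 < a := ipos_iff _ h1
        have := nwi_nonneg l 1 m h3.2
        simp only [nwi, Nat.choose_zero_right]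
        push_cast
        linarith
    · cases l with
      | nil => exact absurd h1 (by simp [hd, inn])
      | cons a l =>
        have h3 : (inp a && allB inp l) = true := h2
        rw [Bool.and_eq_true] at h3
        have h4 : a < 0 := by
          have h1' : (!inn a) = true := h1
          by_contra hh
          rw [(inn_iff a).2 (by linarith)] at h1'
          cases h1'
        have := nwi_nonpos l 1 m h3.2
        simp only [nwi, Nat.choose_zero_right]
        push_cast
        linarith
    · cases m with
      | zero =>
        rw [nw_zero]
        intro h0
        rw [(inn_iff _).2 h0.ge, (inp_iff _).2 h0.le] at h1
        cases h1
      | succ m => rw [← nw_shN]; exact ih _ h2 m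

lemma shNk_spec (k : ℕ) (l : List ℤ) (m : ℕ) : nwi 0 (shNk k l) m = nwi 0 l (m + k) := by
  induction k generalizing m with
  | zero => rfl
  | succ k ih =>
    have e : shNk (k+1) l = shN (shNk k l) := rfl
    rw [e, nw_shN, ih]
    congr 1
    ring

lemma chk_spec (M0 M1 M2 : ℕ) (h : M0 + M1 + M2 = 8) (n : ℕ) (hn : 21 ≤ n) :
    nwi 0 (kaps M1 M2 (tmM M0 M1 M2)) n ≠ 0 := by
  have h0 := chkAll_true
  unfold chkAll at h0
  rw [List.all_eq_true] at h0
  have h1 := h0 M1 (by simp; omega)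
  rw [List.all_eq_true] at h1
  have h2 := h1 M2 (by simp; omega)
  have h3 : (Nat.blt 8 (M1 + M2) || chk (8 - (M1 + M2)) M1 M2) = true := h2
  rw [Bool.or_eq_true, show 8 - (M1 + M2) = M0 by omega] at h3
  rcases h3 with h3 | h3
  · have : Nat.ble 9 (M1 + M2) = true := h3
    have := Nat.le_of_ble_eq_true this
    omega
  · have := good_spec _ _ h3 (n - 21)
    rwa [shNk_spec, show n - 21 + 21 = n by omega] at this

-- the polynomial side
def expo (τ : Tm) : Fin 6 →₀ ℕ := Finsupp.equivFunOnFinite.symm ![τ.r, τ.s, τ.t, τ.w, τ.p, τ.q]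
def tgt (M1 M2 : ℕ) : Fin 6 →₀ ℕ := Finsupp.equivFunOnFinite.symm ![2, 2, 2, 2, M1, M2]
def SP (l : List Tm) : R6 := (l.map fun τ => monomial (expo τ) (τ.c : ℤ)).sum

lemma kap_spec (M1 M2 j : ℕ) (h1 : M1 ≤ 8) (h2 : M2 ≤ 8) (hj : j ≤ 16) (l : List Tm)
    (hl : l.all (fits M1 M2) = true) :
    coeff (tgt M1 M2) (UU ^ j * SP l) = kapL M1 M2 l j := by
  have e : kapL M1 M2 l j = (kapA (itU j) M1 M2 l : ℤ) - HQ * kapB l := by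
    unfold kapL
    rw [Int.subNatNat_eq_coe]
    rw [show Nat.mul HQ (kapB l) = HQ * kapB l from rfl]
    push_cast; rfl
  rw [e]; clear e
  induction l with
  | nil => simp [SP, kapA, kapB]
  | cons τ l ih =>
    rw [List.all_cons, Bool.and_eq_true] at hl
    have ih := ih hl.2
    have eA : kapA (itU j) M1 M2 (τ :: l) = dterm (itU j) M1 M2 τ + kapA (itU j) M1 M2 l := rfl
    have eB : kapB (τ :: l) = τ.c + kapB l := rfl
    have eS : SP (τ :: l) = monomial (expo τ) (τ.c : ℤ) + SP l := by simp [SP]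
    rw [eA, eB, eS, mul_add, coeff_add, ih, mul_comm, coeff_monomial_mul']
    have hf := hl.1
    simp only [fits, Bool.and_eq_true] at hf
    obtain ⟨f0, f1, f2, f3, f4, f5⟩ := hf
    have f0 := Nat.le_of_ble_eq_true f0
    have f1 := Nat.le_of_ble_eq_true f1
    have f2 := Nat.le_of_ble_eq_true f2
    have f3 := Nat.le_of_ble_eq_true f3
    have f4 := Nat.le_of_ble_eq_true f4
    have f5 := Nat.le_of_ble_eq_true f5
    have hle : expo τ ≤ tgt M1 M2 := by
      intro i
      fin_cases i <;> simpa [expo, tgt]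
    rw [if_pos hle, coeff_U j hj]
    · have d0 : (tgt M1 M2 - expo τ) 0 = 2 - τ.r := rfl
      have d1 : (tgt M1 M2 - expo τ) 1 = 2 - τ.s := rfl
      have d2 : (tgt M1 M2 - expo τ) 2 = 2 - τ.t := rfl
      have d3 : (tgt M1 M2 - expo τ) 3 = 2 - τ.w := rfl
      have d4 : (tgt M1 M2 - expo τ) 4 = M1 - τ.p := rfl
      have d5 : (tgt M1 M2 - expo τ) 5 = M2 - τ.q := rfl
      rw [d0, d1, d2, d3, d4, d5]
      have eD : dterm (itU j) M1 M2 τ = τ.c * dgv (look (itU j) (2 - τ.r) (2 - τ.s) (2 - τ.t) (2 - τ.w))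
        (M1 - τ.p) (M2 - τ.q) := rfl
      rw [eD]
      push_cast
      ring
    · show 2 - τ.r < 3
      omega
    · show 2 - τ.s < 3
      omega
    · show 2 - τ.t < 3
      omega
    · show 2 - τ.w < 3
      omega
    · show M1 - τ.p < 9
      omega
    · show M2 - τ.q < 9
      omega

def fitsAll : Bool := tms.all fun τ => fits τ.y τ.z τ
lemma fitsAll_true : fitsAll = true := by decide +kernel

lemma fits_tmM (M0 M1 M2 : ℕ) : (tmM M0 M1 M2).all (fits M1 M2) = true := by
  rw [List.all_eq_true]
  intro τ hτ
  rw [tmM, List.mem_filter] at hτ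
  have h := List.all_eq_true.1 fitsAll_true τ hτ.1
  have h2 := hτ.2
  simp only [isM, Bool.and_eq_true] at h2
  rwa [Nat.eq_of_beq_eq_true h2.1, Nat.eq_of_beq_eq_true h2.2.1] at h

def Low (j : ℕ) (f : R6) : Prop := ∀ m, coeff m f ≠ 0 → j ≤ m.degree
lemma Low.mul {i j : ℕ} {f g : R6} (hf : Low i f) (hg : Low j g) : Low (i + j) (f * g) := by
  classical
  intro m hm
  rw [coeff_mul] at hm
  obtain ⟨x, hx, hne⟩ := Finset.exists_ne_zero_of_sum_ne_zero hm
  rw [Finset.HasAntidiagonal.mem_antidiagonal] at hx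
  rw [← hx, map_add]
  exact add_le_add (hf _ (left_ne_zero_of_mul hne)) (hg _ (right_ne_zero_of_mul hne))
lemma Low.zero (f : R6) : Low 0 f := fun _ _ => Nat.zero_le _
lemma lowU : Low 1 UU := by
  intro m hm
  by_contra h
  have h0 : m = 0 := by
    rw [← Finsupp.degree_eq_zero_iff]; omega
  subst h0
  apply hm
  change constantCoeff UU = 0
  simp [UU, f1, f2, f3, f4]
lemma lowUj (j : ℕ) : Low j (UU ^ j) := by
  induction j with
  | zero => exact Low.zero _
  | succ j ih => rw [pow_succ]; exact ih.mul lowU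

lemma nonvan (M0 M1 M2 : ℕ) (h : M0 + M1 + M2 = 8) (n : ℕ) (hn : 21 ≤ n) :
    coeff (tgt M1 M2) ((f1 * (f2 * (f3 * f4))) ^ n * SP (tmM M0 M1 M2)) ≠ 0 := by
  have h1 := chk_spec M0 M1 M2 h n hn
  convert h1 using 1
  have e : f1 * (f2 * (f3 * f4)) = UU + 1 := by unfold UU; ring
  rw [e, add_pow, Finset.sum_mul, coeff_sum]
  have e2 : ∀ j, coeff (tgt M1 M2) (UU ^ j * 1 ^ (n - j) * (n.choose j : R6) * SP (tmM M0 M1 M2))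
      = coeff (tgt M1 M2) (UU ^ j * SP (tmM M0 M1 M2)) * (n.choose j : ℤ) := by
    intro j
    rw [one_pow, mul_one, show UU ^ j * (n.choose j : R6) * SP (tmM M0 M1 M2) =
      UU ^ j * SP (tmM M0 M1 M2) * (C (n.choose j : ℤ)) by
        rw [show (C (n.choose j : ℤ) : R6) = (n.choose j : R6) by simp]; ring, mul_comm _ (C _), coeff_C_mul, mul_comm]
  simp only [e2]
  rw [← Finset.sum_subset (s₁ := Finset.range 17)]
  · rw [Finset.sum_congr rfl (fun j hj => by
      rw [kap_spec M1 M2 j (by omega) (by omega) (by rw [Finset.mem_range] at hj; omega) _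
        (fits_tmM M0 M1 M2)])]
    simp only [Finset.sum_range_succ, Finset.sum_range_zero, kaps, nwi]
    ring
  · intro x; simp only [Finset.mem_range]; omega
  · intro j _ hj
    have := ((lowUj j).mul (Low.zero (SP (tmM M0 M1 M2)))) (tgt M1 M2)
    by_contra hne
    have h3 := this (left_ne_zero_of_mul hne)
    have h4 : (tgt M1 M2).degree = 2 + 2 + 2 + 2 + M1 + M2 := by
      rw [Finsupp.degree_eq_sum]
      simp [Fin.sum_univ_succ, tgt]
      ring
    rw [Finset.mem_range] at hj
    omega

def tval (v : Fin 6 → ℂ) (τ : Tm) : ℂ :=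
  (τ.c : ℂ) * (v 0 ^ τ.r * v 1 ^ τ.s * v 2 ^ τ.t * v 3 ^ τ.w * v 4 ^ τ.p * v 5 ^ τ.q)
def ev (v : Fin 6 → ℂ) (τ : Tm) : MvP := C (tval v τ) * (X 0 ^ τ.x * X 1 ^ τ.y * X 2 ^ τ.z)
def evl (v : Fin 6 → ℂ) (l : List Tm) : MvP := (l.map (ev v)).sum

lemma ev_mul (v : Fin 6 → ℂ) (a b : Tm) : ev v (tmul a b) = ev v a * ev v b := by
  have : tval v (tmul a b) = tval v a * tval v b := by
    simp only [tval, tmul, Nat.mul_eq, Nat.add_eq, pow_add]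
    push_cast
    ring
  unfold ev
  rw [this]
  simp only [tmul, Nat.add_eq, pow_add, C_mul]
  ring
lemma ev_dbl (v : Fin 6 → ℂ) (a : Tm) : ev v (tdbl a) = 2 * ev v a := by
  have : tval v (tdbl a) = 2 * tval v a := by
    simp only [tval, tdbl, Nat.mul_eq]
    push_cast
    ring
  unfold ev
  rw [this, C_mul, show (C (2 : ℂ) : MvP) = 2 from map_ofNat C 2]
  simp only [tdbl]
  ring
lemma evl_sq (v : Fin 6 → ℂ) (a b c : Tm) : evl v (sq6 a b c) = (ev v a + ev v b + ev v c) ^ 2 := by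
  simp only [evl, sq6, List.map_cons, List.map_nil, List.sum_cons, List.sum_nil, ev_mul, ev_dbl]
  ring
lemma evl_mul (v : Fin 6 → ℂ) (l m : List Tm) : evl v (lmul l m) = evl v l * evl v m := by
  induction l with
  | nil => simp [evl, lmul]
  | cons a l ih =>
    have e : lmul (a :: l) m = m.map (tmul a) ++ lmul l m := rfl
    have e2 : evl v (m.map (tmul a)) = ev v a * evl v m := by
      clear e ih
      induction m with
      | nil => simp [evl]
      | cons b m ih =>
        simp only [evl, List.map_cons, List.sum_cons, ev_mul, mul_add] at ih ⊢
        rw [ih]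
    have e3 : evl v (m.map (tmul a) ++ lmul l m) = evl v (m.map (tmul a)) + evl v (lmul l m) := by
      simp [evl]
    have e4 : evl v (a :: l) = ev v a + evl v l := by simp [evl]
    rw [e, e3, e2, ih, e4, add_mul]

def va (v : Fin 6 → ℂ) : Fin 3 → ℂ := ![1, v 4, v 5]
def vb (v : Fin 6 → ℂ) : Fin 3 → ℂ := ![v 0, 1, v 1]
def vc (v : Fin 6 → ℂ) : Fin 3 → ℂ := ![v 2, v 3, 1]
def ve : Fin 3 → ℂ := ![1, 1, 1]

lemma evl_tms (v : Fin 6 → ℂ) : evl v tms = (prod4sq (va v) (vb v) (vc v) ve : MvP) := by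
  unfold tms
  rw [evl_mul, evl_mul, evl_mul, evl_sq, evl_sq, evl_sq, evl_sq]
  simp only [prod4sq, lin, Fin.sum_univ_three, va, vb, vc, ve]
  simp [ev, tval]

lemma coeff_ev (v : Fin 6 → ℂ) (τ : Tm) (M0 M1 M2 : ℕ) :
    coeff (Finsupp.equivFunOnFinite.symm ![M0, M1, M2]) (ev v τ) =
      if isM M0 M1 M2 τ = true then tval v τ else 0 := by
  have e : ev v τ = monomial (Finsupp.equivFunOnFinite.symm ![τ.x, τ.y, τ.z]) (tval v τ) := by
    rw [monomial_eq, ev, Finsupp.prod_fintype _ _ (fun _ => pow_zero _), Fin.prod_univ_three]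
    simp
  rw [e, coeff_monomial]
  congr 1
  rw [Equiv.apply_eq_iff_eq]
  simp only [isM, Bool.and_eq_true, eq_iff_iff]
  constructor
  · intro h
    have h0 := congrFun h 0
    have h1 := congrFun h 1
    have h2 := congrFun h 2
    simp at h0 h1 h2
    simp [h0, h1, h2]
  · rintro ⟨h1, h2, h0⟩
    rw [Nat.eq_of_beq_eq_true h0, Nat.eq_of_beq_eq_true h1, Nat.eq_of_beq_eq_true h2]

lemma coeff_evl (v : Fin 6 → ℂ) (l : List Tm) (M0 M1 M2 : ℕ) :
    coeff (Finsupp.equivFunOnFinite.symm ![M0, M1, M2]) (evl v l) =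
      eval v (map (Int.castRingHom ℂ) (SP (l.filter (isM M0 M1 M2)))) := by
  induction l with
  | nil => simp [evl, SP]
  | cons τ l ih =>
    have e4 : evl v (τ :: l) = ev v τ + evl v l := by simp [evl]
    rw [e4, coeff_add, ih, coeff_ev, List.filter_cons]
    split_ifs with h
    · have : SP (τ :: l.filter (isM M0 M1 M2)) = monomial (expo τ) (τ.c : ℤ) + SP (l.filter (isM M0 M1 M2)) := by
        simp [SP]
      rw [this, map_add, map_add, map_monomial, eval_monomial, Finsupp.prod_fintype _ _ (fun _ => pow_zero _)]
      simp only [Fin.prod_univ_six]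
      congr 1
    · simp

lemma bridge (v : Fin 6 → ℂ) (n M0 M1 M2 : ℕ) :
    (Icov (va v) (vb v) (vc v) ve) ^ n * coeff (Finsupp.equivFunOnFinite.symm ![M0, M1, M2])
      (prod4sq (va v) (vb v) (vc v) ve : MvP) =
    eval v (C ((-1) ^ n) * map (Int.castRingHom ℂ) ((f1 * (f2 * (f3 * f4))) ^ n * SP (tmM M0 M1 M2))) := by
  rw [← evl_tms, coeff_evl, map_mul, map_mul, map_mul, eval_C, ← mul_assoc]
  congr 1
  rw [map_pow, map_pow, ← mul_pow]
  congr 1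
  simp only [Icov, br, Matrix.det_fin_three, va, vb, vc, ve, f1, f2, f3, f4]
  simp
  ring

lemma nonvanC (M0 M1 M2 : ℕ) (h : M0 + M1 + M2 = 8) (n : ℕ) (hn : 21 ≤ n) :
    coeff (tgt M1 M2) (C ((-1) ^ n) * map (Int.castRingHom ℂ)
      ((f1 * (f2 * (f3 * f4))) ^ n * SP (tmM M0 M1 M2))) ≠ 0 := by
  rw [coeff_C_mul, coeff_map]
  refine mul_ne_zero (pow_ne_zero _ (by norm_num)) ?_
  have := nonvan M0 M1 M2 h n hn
  simpa using this

abbrev fs (k : Fin 3 → ℕ) : Fin 3 →₀ ℕ := Finsupp.equivFunOnFinite.symm k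

def mV (d : ℕ) (k : Fin 3 → ℕ) : V d :=
  if h : ∑ i, k i = d then ⟨monomial (fs k) 1, by
    rw [V, mem_homogeneousSubmodule]
    apply isHomogeneous_monomial
    rw [Finsupp.degree_eq_sum]
    exact h⟩ else 0

lemma mV_coe {d : ℕ} {k : Fin 3 → ℕ} (h : ∑ i, k i = d) : (mV d k : MvP) = monomial (fs k) 1 := by
  unfold mV; rw [dif_pos h]

def AD (d : ℕ) : Finset (Fin 3 → ℕ) := Finset.piAntidiag Finset.univ d
lemma mem_AD {d : ℕ} {k : Fin 3 → ℕ} : k ∈ AD d ↔ ∑ i, k i = d := by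
  simp [AD]

def PP (a : Fin 3 → ℂ) (k : Fin 3 → ℕ) : ℂ := (Nat.multinomial Finset.univ k : ℂ) * ∏ i, a i ^ k i

lemma powV_exp (d : ℕ) (a : Fin 3 → ℂ) : powV d a = ∑ k ∈ AD d, PP a k • mV d k := by
  apply Subtype.ext
  rw [AddSubmonoidClass.coe_finsetSum]
  show lin a ^ d = _
  rw [lin, Finset.sum_pow_eq_sum_piAntidiag]
  refine Finset.sum_congr rfl fun k hk => ?_
  rw [SetLike.val_smul, mV_coe (mem_AD.1 hk), monomial_eq,
    Finsupp.prod_fintype _ _ (fun _ => pow_zero _), smul_eq_C_mul]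
  simp only [PP, mul_pow, Finset.prod_mul_distrib, C_mul, map_natCast, map_prod, map_pow]
  simp
  ring

lemma lem_A (d : ℕ) (w w' : (Fin 3 → ℕ) → ℂ)
    (h : ∀ a, ∑ k ∈ AD d, PP a k * w k = ∑ k ∈ AD d, PP a k * w' k) :
    ∀ k ∈ AD d, w k = w' k := by
  classical
  have h2 : ∑ k ∈ AD d, monomial (fs k) ((Nat.multinomial Finset.univ k : ℂ) * w k) =
      ∑ k ∈ AD d, monomial (fs k) ((Nat.multinomial Finset.univ k : ℂ) * w' k) := by
    apply MvPolynomial.funext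
    intro a
    simp only [map_sum, eval_monomial, Finsupp.prod_fintype _ _ (fun _ => pow_zero _)]
    convert h a using 2 with k _ k _
    · simp [PP]; ring
    · simp [PP]; ring
  intro k hk
  have h3 := congrArg (coeff (fs k)) h2
  simp only [coeff_sum, coeff_monomial, EmbeddingLike.apply_eq_iff_eq] at h3
  rw [Finset.sum_ite_eq' , Finset.sum_ite_eq', if_pos hk, if_pos hk] at h3
  exact mul_left_cancel₀ (Nat.cast_ne_zero.2 (Nat.multinomial_pos _ _).ne') h3

lemma expansion {n : ℕ} (Ψ : MultilinearMap ℂ (fun _ : Fin 4 => V (3*n+2)) (V 8)) (M : Fin 3 →₀ ℕ)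
    (a b c e : Fin 3 → ℂ) :
    coeff M (Ψ ![powV (3*n+2) a, powV (3*n+2) b, powV (3*n+2) c, powV (3*n+2) e] : MvP) =
    ∑ k ∈ AD (3*n+2), PP a k * ∑ l ∈ AD (3*n+2), PP b l * ∑ m ∈ AD (3*n+2), PP c m *
      ∑ o ∈ AD (3*n+2), PP e o *
      coeff M (Ψ ![mV (3*n+2) k, mV (3*n+2) l, mV (3*n+2) m, mV (3*n+2) o] : MvP) := by
  let cf : V 8 →ₗ[ℂ] ℂ := (lcoeff ℂ M).comp (V 8).subtype
  have key : ∀ (L : V (3*n+2) →ₗ[ℂ] ℂ) (a : Fin 3 → ℂ),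
      L (powV (3*n+2) a) = ∑ k ∈ AD (3*n+2), PP a k * L (mV (3*n+2) k) := by
    intro L a
    rw [powV_exp, map_sum]
    simp
  have s0 : ∀ x y z w : V (3*n+2), (coeff M (Ψ ![x,y,z,w] : MvP)) =
      (cf.comp (Ψ.toLinearMap ![0,y,z,w] 0)) x := by
    intro x y z w
    have : Function.update ![0,y,z,w] 0 x = ![x,y,z,w] := by
      ext i; fin_cases i <;> rfl
    simp [cf, this]
  have s1 : ∀ x y z w : V (3*n+2), (coeff M (Ψ ![x,y,z,w] : MvP)) =
      (cf.comp (Ψ.toLinearMap ![x,0,z,w] 1)) y := by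
    intro x y z w
    have : Function.update ![x,0,z,w] 1 y = ![x,y,z,w] := by
      ext i; fin_cases i <;> rfl
    simp [cf, this]
  have s2 : ∀ x y z w : V (3*n+2), (coeff M (Ψ ![x,y,z,w] : MvP)) =
      (cf.comp (Ψ.toLinearMap ![x,y,0,w] 2)) z := by
    intro x y z w
    have : Function.update ![x,y,0,w] 2 z = ![x,y,z,w] := by
      ext i; fin_cases i <;> rfl
    simp [cf, this]
  have s3 : ∀ x y z w : V (3*n+2), (coeff M (Ψ ![x,y,z,w] : MvP)) =
      (cf.comp (Ψ.toLinearMap ![x,y,z,0] 3)) w := by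
    intro x y z w
    have : Function.update ![x,y,z,0] 3 w = ![x,y,z,w] := by
      ext i; fin_cases i <;> rfl
    simp [cf, this]
  rw [s0, key]
  refine Finset.sum_congr rfl fun k _ => ?_
  rw [← s0, s1, key]
  congr 1
  refine Finset.sum_congr rfl fun l _ => ?_
  rw [← s1, s2, key]
  congr 1
  refine Finset.sum_congr rfl fun m _ => ?_
  rw [← s2, s3, key]
  congr 1
  refine Finset.sum_congr rfl fun o _ => ?_
  rw [← s3]

lemma PP_scale (t a : Fin 3 → ℂ) (k : Fin 3 → ℕ) : PP (t * a) k = PP a k * ∏ i, t i ^ k i := by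
  simp only [PP, Pi.mul_apply, mul_pow, Finset.prod_mul_distrib]; ring

lemma br_scale (t a b c : Fin 3 → ℂ) : br (t * a) (t * b) (t * c) = (∏ i, t i) * br a b c := by
  simp only [br, Matrix.det_fin_three, Fin.prod_univ_three]
  simp
  ring
lemma Icov_scale (t a b c e : Fin 3 → ℂ) :
    Icov (t * a) (t * b) (t * c) (t * e) = (∏ i, t i) ^ 4 * Icov a b c e := by
  simp only [Icov, br_scale]; ring

lemma coeff_scale (t : Fin 3 → ℂ) (M : Fin 3 →₀ ℕ) (f : MvP) :
    coeff M (aeval (fun i => C (t i) * X i : Fin 3 → MvP) f) = (∏ i, t i ^ M i) * coeff M f := by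
  classical
  induction f using MvPolynomial.induction_on' with
  | monomial u r =>
    rw [aeval_monomial, Finsupp.prod_fintype _ _ (fun _ => pow_zero _)]
    have : (algebraMap ℂ MvP r * ∏ i, (C (t i) * X i : MvP) ^ u i) =
        monomial u (r * ∏ i, t i ^ u i) := by
      rw [monomial_eq, Finsupp.prod_fintype _ _ (fun _ => pow_zero _)]
      simp only [mul_pow, Finset.prod_mul_distrib, C_mul, map_prod, map_pow, algebraMap_eq]
      ring
    rw [this, coeff_monomial, coeff_monomial]
    split_ifs with h
    · rw [h]; ring
    · simp
  | add p q hp hq => rw [map_add, coeff_add, hp, hq, coeff_add]; ring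

lemma prod_scale (t a b c e : Fin 3 → ℂ) (M : Fin 3 →₀ ℕ) :
    coeff M (prod4sq (t * a) (t * b) (t * c) (t * e) : MvP) =
      (∏ i, t i ^ M i) * coeff M (prod4sq a b c e : MvP) := by
  rw [← coeff_scale]
  have : ∀ a, lin (t * a) = aeval (fun i => C (t i) * X i : Fin 3 → MvP) (lin a) := by
    intro a
    simp only [lin, map_sum, map_mul, aeval_X, aeval_C, algebraMap_eq, Pi.mul_apply]
    refine Finset.sum_congr rfl fun i _ => ?_
    ring
  simp only [prod4sq, this, map_mul, map_pow]

lemma weight {n : ℕ} (Ψ : MultilinearMap ℂ (fun _ : Fin 4 => V (3*n+2)) (V 8)) (hΨ : IsClebschT n Ψ)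
    (M : Fin 3 →₀ ℕ) (k l m o : Fin 3 → ℕ)
    (hk : k ∈ AD (3*n+2)) (hl : l ∈ AD (3*n+2)) (hm : m ∈ AD (3*n+2)) (ho : o ∈ AD (3*n+2))
    (hne : coeff M (Ψ ![mV (3*n+2) k, mV (3*n+2) l, mV (3*n+2) m, mV (3*n+2) o] : MvP) ≠ 0)
    (j : Fin 3) : k j + l j + m j + o j = 4 * n + M j := by
  have main : ∀ t : Fin 3 → ℂ, (∏ i, t i ^ k i) * ((∏ i, t i ^ l i) * ((∏ i, t i ^ m i) *
      (∏ i, t i ^ o i))) = (∏ i, t i) ^ (4 * n) * ∏ i, t i ^ M i := by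
    intro t
    set D : (Fin 3 → ℕ) → (Fin 3 → ℕ) → (Fin 3 → ℕ) → (Fin 3 → ℕ) → ℂ := fun k l m o =>
      coeff M (Ψ ![mV (3*n+2) k, mV (3*n+2) l, mV (3*n+2) m, mV (3*n+2) o] : MvP) with hD
    have h : ∀ a b c e : Fin 3 → ℂ,
        ∑ k ∈ AD (3*n+2), PP a k * ∑ l ∈ AD (3*n+2), PP b l * ∑ m ∈ AD (3*n+2), PP c m *
          ∑ o ∈ AD (3*n+2), PP e o * ((∏ i, t i ^ k i) * ((∏ i, t i ^ l i) * ((∏ i, t i ^ m i) *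
            ((∏ i, t i ^ o i) * D k l m o)))) =
        ∑ k ∈ AD (3*n+2), PP a k * ∑ l ∈ AD (3*n+2), PP b l * ∑ m ∈ AD (3*n+2), PP c m *
          ∑ o ∈ AD (3*n+2), PP e o * (((∏ i, t i) ^ (4 * n) * ∏ i, t i ^ M i) * D k l m o) := by
      intro a b c e
      have h1 := expansion Ψ M a b c e
      have h2 := expansion Ψ M (t * a) (t * b) (t * c) (t * e)
      rw [hΨ.2, SetLike.val_smul, coeff_smul, smul_eq_mul] at h1 h2
      rw [Icov_scale, prod_scale] at h2
      have h3 := h2.symm.trans (show _ = ((∏ i, t i) ^ (4 * n) * ∏ i, t i ^ M i) *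
        (Icov a b c e ^ n * coeff M (prod4sq a b c e : MvP)) by ring)
      rw [h1] at h3
      simp only [PP_scale, Finset.mul_sum] at h3 ⊢
      refine Eq.trans ?_ (h3.trans ?_)
      · refine Finset.sum_congr rfl fun k _ => Finset.sum_congr rfl fun l _ =>
          Finset.sum_congr rfl fun m _ => Finset.sum_congr rfl fun o _ => ?_
        ring
      · refine Finset.sum_congr rfl fun k _ => Finset.sum_congr rfl fun l _ =>
          Finset.sum_congr rfl fun m _ => Finset.sum_congr rfl fun o _ => ?_
        ring
    have h1 := fun b c e => lem_A _ _ _ (fun a => h a b c e) k hk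
    have h2 := fun c e => lem_A _ _ _ (fun b => h1 b c e) l hl
    have h3 := fun e => lem_A _ _ _ (fun c => h2 c e) m hm
    have h4 := lem_A _ _ _ (fun e => h3 e) o ho
    apply mul_right_cancel₀ hne
    linear_combination h4
  have h := main (fun i => if i = j then 2 else 1)
  have e : ∀ k : Fin 3 → ℕ, ∏ i, (if i = j then (2:ℂ) else 1) ^ k i = 2 ^ k j := by
    intro k
    rw [Finset.prod_eq_single j]
    · simp
    · intro b _ hb; simp [hb]
    · simp
  have e1 : ∏ i, (if i = j then (2:ℂ) else 1) = 2 := by simp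
  rw [e, e, e, e, e, e1, ← pow_add, ← pow_add, ← pow_add, ← pow_add] at h
  have h5 : (2:ℕ) ^ (k j + (l j + (m j + o j))) = 2 ^ (4 * n + M j) := by exact_mod_cast h
  have := Nat.pow_right_injective (le_refl 2) h5
  omega

end CC

namespace CC
def eB (n : ℕ) : Fin 3 → ℕ := ![2, 3*n-2, 2]
def eG (n : ℕ) : Fin 3 → ℕ := ![2, 2, 3*n-2]
def eD (n : ℕ) : Fin 3 → ℕ := ![n+2, n, n]
def eA (n M0 M1 M2 : ℕ) : Fin 3 → ℕ := ![3*n-6+M0, M1, M2]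

lemma eB_mem (n : ℕ) (hn : 21 ≤ n) : eB n ∈ AD (3*n+2) := by
  rw [mem_AD, Fin.sum_univ_three]; simp [eB]; omega
lemma eG_mem (n : ℕ) (hn : 21 ≤ n) : eG n ∈ AD (3*n+2) := by
  rw [mem_AD, Fin.sum_univ_three]; simp [eG]; omega
lemma eD_mem (n : ℕ) : eD n ∈ AD (3*n+2) := by
  rw [mem_AD, Fin.sum_univ_three]; simp [eD]; omega
lemma eA_mem (n M0 M1 M2 : ℕ) (hn : 21 ≤ n) (h : M0 + M1 + M2 = 8) : eA n M0 M1 M2 ∈ AD (3*n+2) := by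
  rw [mem_AD, Fin.sum_univ_three]; simp [eA]; omega

def ex3 (k l m : Fin 3 → ℕ) : Fin 6 →₀ ℕ :=
  Finsupp.equivFunOnFinite.symm ![l 0, l 2, m 0, m 1, k 1, k 2]
def mn (k : Fin 3 → ℕ) : ℂ := (Nat.multinomial Finset.univ k : ℂ)

lemma key_ne {n : ℕ} (hn : 21 ≤ n) (Ψ : MultilinearMap ℂ (fun _ : Fin 4 => V (3*n+2)) (V 8))
    (hΨ : IsClebschT n Ψ) (M0 M1 M2 : ℕ) (h : M0 + M1 + M2 = 8) :
    coeff (fs ![M0, M1, M2]) (Ψ ![mV (3*n+2) (eA n M0 M1 M2), mV (3*n+2) (eB n), mV (3*n+2) (eG n),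
      mV (3*n+2) (eD n)] : MvP) ≠ 0 := by
  classical
  set M := fs ![M0, M1, M2] with hM
  set D : (Fin 3 → ℕ) → (Fin 3 → ℕ) → (Fin 3 → ℕ) → (Fin 3 → ℕ) → ℂ := fun k l m o =>
      coeff M (Ψ ![mV (3*n+2) k, mV (3*n+2) l, mV (3*n+2) m, mV (3*n+2) o] : MvP) with hD
  have h1 : ∑ k ∈ AD (3*n+2), ∑ l ∈ AD (3*n+2), ∑ m ∈ AD (3*n+2), ∑ o ∈ AD (3*n+2),
      monomial (ex3 k l m) (mn k * mn l * mn m * mn o * D k l m o) =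
      C ((-1) ^ n) * map (Int.castRingHom ℂ) ((f1 * (f2 * (f3 * f4))) ^ n * SP (tmM M0 M1 M2)) := by
    apply MvPolynomial.funext
    intro v
    rw [← bridge]
    have h2 := expansion Ψ M (va v) (vb v) (vc v) ve
    rw [hΨ.2, SetLike.val_smul, coeff_smul, smul_eq_mul] at h2
    rw [h2]
    simp only [map_sum, Finset.mul_sum, eval_monomial, Finsupp.prod_fintype _ _ (fun _ => pow_zero _)]
    refine Finset.sum_congr rfl fun k _ => Finset.sum_congr rfl fun l _ =>
          Finset.sum_congr rfl fun m _ => Finset.sum_congr rfl fun o _ => ?_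
    simp only [PP, Fin.prod_univ_three, Fin.prod_univ_six]
    simp [ex3, mn, va, vb, vc, ve, hD]
    ring
  have h2 := nonvanC M0 M1 M2 h n hn
  rw [← h1, coeff_sum] at h2
  obtain ⟨k, hk, h2⟩ := Finset.exists_ne_zero_of_sum_ne_zero h2
  rw [coeff_sum] at h2
  obtain ⟨l, hl, h2⟩ := Finset.exists_ne_zero_of_sum_ne_zero h2
  rw [coeff_sum] at h2
  obtain ⟨m, hm, h2⟩ := Finset.exists_ne_zero_of_sum_ne_zero h2
  rw [coeff_sum] at h2
  obtain ⟨o, ho, h2⟩ := Finset.exists_ne_zero_of_sum_ne_zero h2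
  rw [coeff_monomial] at h2
  split_ifs at h2 with h3
  swap
  · exact absurd rfl h2
  have h4 := right_ne_zero_of_mul h2
  have hw := weight Ψ hΨ M k l m o hk hl hm ho h4
  have w0 := hw 0
  have w1 := hw 1
  have w2 := hw 2
  have m0 : M 0 = M0 := rfl
  have m1 : M 1 = M1 := rfl
  have m2 : M 2 = M2 := rfl
  have g0 : l 0 = 2 := DFunLike.congr_fun h3 0
  have g1 : l 2 = 2 := DFunLike.congr_fun h3 1
  have g2 : m 0 = 2 := DFunLike.congr_fun h3 2
  have g3 : m 1 = 2 := DFunLike.congr_fun h3 3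
  have g4 : k 1 = M1 := DFunLike.congr_fun h3 4
  have g5 : k 2 = M2 := DFunLike.congr_fun h3 5
  rw [mem_AD, Fin.sum_univ_three] at hk hl hm ho
  have ek : k = eA n M0 M1 M2 := by
    funext i; fin_cases i <;> simp [eA] <;> omega
  have el : l = eB n := by
    funext i; fin_cases i <;> simp [eB] <;> omega
  have em : m = eG n := by
    funext i; fin_cases i <;> simp [eG] <;> omega
  have eo : o = eD n := by
    funext i; fin_cases i <;> simp [eD] <;> omega
  rw [ek, el, em, eo] at h4
  exact h4

lemma swap4 {n : ℕ} (Ψ : MultilinearMap ℂ (fun _ : Fin 4 => V (3*n+2)) (V 8)) (hΨ : IsClebschT n Ψ)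
    (x y z w : V (3*n+2)) : Ψ ![x, y, w, z] = Ψ ![x, y, z, w] ∧ Ψ ![x, z, y, w] = Ψ ![x, y, z, w] := by
  constructor
  · rw [← hΨ.1 ![x, y, z, w] (Equiv.swap 2 3)]
    congr 1
    ext i; fin_cases i <;> rfl
  · rw [← hΨ.1 ![x, y, z, w] (Equiv.swap 1 2)]
    congr 1
    ext i; fin_cases i <;> rfl

lemma zero_of {n : ℕ} (Ψ : MultilinearMap ℂ (fun _ : Fin 4 => V (3*n+2)) (V 8)) (hΨ : IsClebschT n Ψ)
    (k l m o : Fin 3 → ℕ)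
    (hk : k ∈ AD (3*n+2)) (hl : l ∈ AD (3*n+2)) (hm : m ∈ AD (3*n+2)) (ho : o ∈ AD (3*n+2))
    (j : Fin 3) (hj : k j + l j + m j + o j < 4 * n) :
    Ψ ![mV (3*n+2) k, mV (3*n+2) l, mV (3*n+2) m, mV (3*n+2) o] = 0 := by
  apply Subtype.ext
  apply MvPolynomial.ext
  intro M
  by_contra h
  have := weight Ψ hΨ M k l m o hk hl hm ho (by simpa using h) j
  omega

lemma eval_hg {n : ℕ} (hn : 21 ≤ n) (Ψ : MultilinearMap ℂ (fun _ : Fin 4 => V (3*n+2)) (V 8))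
    (hΨ : IsClebschT n Ψ) (M0 M1 M2 : ℕ) (h : M0 + M1 + M2 = 8) (g : V (3*n+2))
    (hg : g = mV (3*n+2) (eB n) + mV (3*n+2) (eG n) + mV (3*n+2) (eD n)) :
    Ψ ![mV (3*n+2) (eA n M0 M1 M2), g, g, g] = (6:ℂ) • Ψ ![mV (3*n+2) (eA n M0 M1 M2),
      mV (3*n+2) (eB n), mV (3*n+2) (eG n), mV (3*n+2) (eD n)] := by
  have hA := eA_mem n M0 M1 M2 hn h
  have hB := eB_mem n hn
  have hG := eG_mem n hn
  have hD := eD_mem n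
  have a1 : eA n M0 M1 M2 1 = M1 := rfl
  have a2 : eA n M0 M1 M2 2 = M2 := rfl
  have b1 : eB n 1 = 3*n-2 := rfl
  have b2 : eB n 2 = 2 := rfl
  have c1 : eG n 1 = 2 := rfl
  have c2 : eG n 2 = 3*n-2 := rfl
  have d1 : eD n 1 = n := rfl
  have d2 : eD n 2 = n := rfl
  have z := fun l m o hl hm ho => zero_of Ψ hΨ (eA n M0 M1 M2) l m o hA hl hm ho
  have u1 : ∀ x y y' z w : V (3*n+2), Ψ ![x, y + y', z, w] = Ψ ![x, y, z, w] + Ψ ![x, y', z, w] := by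
    intro x y y' z w
    have := Ψ.map_update_add ![x, 0, z, w] 1 y y'
    have e : ∀ y, Function.update ![x, 0, z, w] 1 y = ![x, y, z, w] := by
      intro y; ext i; fin_cases i <;> rfl
    rwa [e, e, e] at this
  have u2 : ∀ x y z z' w : V (3*n+2), Ψ ![x, y, z + z', w] = Ψ ![x, y, z, w] + Ψ ![x, y, z', w] := by
    intro x y z z' w
    rw [← (swap4 Ψ hΨ x y _ w).2, u1, (swap4 Ψ hΨ x y _ w).2, (swap4 Ψ hΨ x y _ w).2]
  have u3 : ∀ x y z w w' : V (3*n+2), Ψ ![x, y, z, w + w'] = Ψ ![x, y, z, w] + Ψ ![x, y, z, w'] := by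
    intro x y z w w'
    rw [← (swap4 Ψ hΨ x y z _).1, u2, (swap4 Ψ hΨ x y z _).1, (swap4 Ψ hΨ x y z _).1]
  have zBB : ∀ o ∈ ({eB n, eG n, eD n} : Set (Fin 3 → ℕ)), Ψ ![mV (3*n+2) (eA n M0 M1 M2),
      mV (3*n+2) (eB n), mV (3*n+2) (eB n), mV (3*n+2) o] = 0 := by
    rintro o (rfl | rfl | rfl)
    · exact z _ _ _ hB hB hB 2 (by omega)
    · exact z _ _ _ hB hB hG 2 (by omega)
    · exact z _ _ _ hB hB hD 2 (by omega)
  have zGG : ∀ o ∈ ({eB n, eG n, eD n} : Set (Fin 3 → ℕ)), Ψ ![mV (3*n+2) (eA n M0 M1 M2),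
      mV (3*n+2) (eG n), mV (3*n+2) (eG n), mV (3*n+2) o] = 0 := by
    rintro o (rfl | rfl | rfl)
    · exact z _ _ _ hG hG hB 1 (by omega)
    · exact z _ _ _ hG hG hG 1 (by omega)
    · exact z _ _ _ hG hG hD 1 (by omega)
  have zDD : ∀ o ∈ ({eB n, eG n, eD n} : Set (Fin 3 → ℕ)), Ψ ![mV (3*n+2) (eA n M0 M1 M2),
      mV (3*n+2) (eD n), mV (3*n+2) (eD n), mV (3*n+2) o] = 0 := by
    rintro o (rfl | rfl | rfl)
    · exact z _ _ _ hD hD hB 2 (by omega)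
    · exact z _ _ _ hD hD hG 1 (by omega)
    · exact z _ _ _ hD hD hD 1 (by omega)
  have B1 := zBB (eB n) (by simp)
  have B2 := zBB (eG n) (by simp)
  have B3 := zBB (eD n) (by simp)
  have G1 := zGG (eB n) (by simp)
  have G2 := zGG (eG n) (by simp)
  have G3 := zGG (eD n) (by simp)
  have D1 := zDD (eB n) (by simp)
  have D2 := zDD (eG n) (by simp)
  have D3 := zDD (eD n) (by simp)
  clear z zBB zGG zDD hA hB hG hD
  generalize mV (3*n+2) (eA n M0 M1 M2) = x at *
  generalize mV (3*n+2) (eB n) = b at *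
  generalize mV (3*n+2) (eG n) = c at *
  generalize mV (3*n+2) (eD n) = e at *
  have s1 := fun y z w => (swap4 Ψ hΨ x y z w).1
  have s2 := fun y z w => (swap4 Ψ hΨ x y z w).2
  have t1 : Ψ ![x, b, c, b] = 0 := by rw [s1, B2]
  have t2 : Ψ ![x, c, b, b] = 0 := by rw [s2, t1]
  have t3 : Ψ ![x, b, e, b] = 0 := by rw [s1, B3]
  have t4 : Ψ ![x, e, b, b] = 0 := by rw [s2, t3]
  have t5 : Ψ ![x, c, b, c] = 0 := by rw [s1, G1]
  have t6 : Ψ ![x, b, c, c] = 0 := by rw [s2, t5]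
  have t7 : Ψ ![x, c, e, c] = 0 := by rw [s1, G3]
  have t8 : Ψ ![x, e, c, c] = 0 := by rw [s2, t7]
  have t9 : Ψ ![x, e, b, e] = 0 := by rw [s1, D1]
  have t10 : Ψ ![x, b, e, e] = 0 := by rw [s2, t9]
  have t11 : Ψ ![x, e, c, e] = 0 := by rw [s1, D2]
  have t12 : Ψ ![x, c, e, e] = 0 := by rw [s2, t11]
  have r1 : Ψ ![x, b, e, c] = Ψ ![x, b, c, e] := s1 _ _ _
  have r2 : Ψ ![x, c, b, e] = Ψ ![x, b, c, e] := s2 _ _ _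
  have r3 : Ψ ![x, c, e, b] = Ψ ![x, b, c, e] := by rw [s1, r2]
  have r4 : Ψ ![x, e, b, c] = Ψ ![x, b, c, e] := by rw [s2, r1]
  have r5 : Ψ ![x, e, c, b] = Ψ ![x, b, c, e] := by rw [s1, r4]
  rw [hg]
  simp only [u1, u2, u3, B1, B2, B3, G1, G2, G3, D1, D2, D3, t1, t2, t3, t4, t5, t6, t7, t8, t9, t10,
    t11, t12, r1, r2, r3, r4, r5]
  module

lemma mono_eq {n : ℕ} (hn : 21 ≤ n) (Ψ : MultilinearMap ℂ (fun _ : Fin 4 => V (3*n+2)) (V 8))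
    (hΨ : IsClebschT n Ψ) (M0 M1 M2 : ℕ) (h : M0 + M1 + M2 = 8) :
    ∃ K : ℂ, K ≠ 0 ∧ Ψ ![mV (3*n+2) (eA n M0 M1 M2),
      mV (3*n+2) (eB n), mV (3*n+2) (eG n), mV (3*n+2) (eD n)] = K • mV 8 ![M0, M1, M2] := by
  classical
  refine ⟨_, key_ne hn Ψ hΨ M0 M1 M2 h, ?_⟩
  apply Subtype.ext
  apply MvPolynomial.ext
  intro M
  rw [SetLike.val_smul, coeff_smul, mV_coe (by rw [Fin.sum_univ_three]; simpa using h), coeff_monomial]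
  split_ifs with hM
  · rw [← hM]; simp
  · rw [smul_zero]
    by_contra hne
    apply hM
    have hw := weight Ψ hΨ M _ _ _ _ (eA_mem n M0 M1 M2 hn h) (eB_mem n hn) (eG_mem n hn) (eD_mem n) hne
    have w0 := hw 0
    have w1 := hw 1
    have w2 := hw 2
    simp [eA, eB, eG, eD] at w0 w1 w2
    ext i
    fin_cases i <;> simp [fs] <;> omega

lemma span_mV (S : Submodule ℂ (V 8)) (h : ∀ M0 M1 M2, M0 + M1 + M2 = 8 → mV 8 ![M0, M1, M2] ∈ S) :
    S = ⊤ := by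
  rw [eq_top_iff]
  intro f _
  have hd : ∀ M ∈ (f : MvP).support, M 0 + M 1 + M 2 = 8 := by
    intro M hM
    have h1 : (f : MvP).IsHomogeneous 8 := (mem_homogeneousSubmodule 8 (f : MvP)).1 f.2
    have h2 := h1.degree_eq_sum_deg_support hM
    change 8 = M.degree at h2
    rw [Finsupp.degree_eq_sum, Fin.sum_univ_three] at h2
    exact h2.symm
  have hf : f = ∑ M ∈ (f : MvP).support, coeff M (f : MvP) • mV 8 ![M 0, M 1, M 2] := by
    apply Subtype.ext
    rw [AddSubmonoidClass.coe_finsetSum]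
    conv_lhs => rw [(f : MvP).as_sum]
    refine Finset.sum_congr rfl fun M hM => ?_
    have h2 : M = fs ![M 0, M 1, M 2] := by
      ext i; fin_cases i <;> rfl
    rw [SetLike.val_smul, mV_coe (by rw [Fin.sum_univ_three]; exact hd M hM), ← h2, smul_monomial]
    simp
  rw [hf]
  refine Submodule.sum_mem _ fun M hM => Submodule.smul_mem _ _ (h _ _ _ (hd M hM))
end CC

theorem stmt17 (n : ℕ) (hn : 21 ≤ n)
    (Ψ : MultilinearMap ℂ (fun _ : Fin 4 => V (3*n+2)) (V 8)) (hΨ : IsClebschT n Ψ) :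
    ∃ g : V (3*n+2),
      Submodule.span ℂ
        (((fun h => Ψ ![h, g, g, g]) '' {h : V (3*n+2) | memLT n h}) ∪ {Ψ ![g, g, g, g]})
        = ⊤ := by
  refine ⟨CC.mV (3*n+2) (CC.eB n) + CC.mV (3*n+2) (CC.eG n) + CC.mV (3*n+2) (CC.eD n), ?_⟩
  apply CC.span_mV
  intro M0 M1 M2 h
  obtain ⟨K, hK, hE⟩ := CC.mono_eq hn Ψ hΨ M0 M1 M2 h
  have e := CC.eval_hg hn Ψ hΨ M0 M1 M2 h _ rfl
  rw [hE, smul_smul] at e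
  have e2 : CC.mV 8 ![M0, M1, M2] = (6 * K)⁻¹ • ((6 * K) • CC.mV 8 ![M0, M1, M2]) := by
    rw [smul_smul, inv_mul_cancel₀ (mul_ne_zero (by norm_num) hK), one_smul]
  rw [e2, ← e]
  apply Submodule.smul_mem
  apply Submodule.subset_span
  left
  refine ⟨_, ?_, rfl⟩
  show (X 0 : MvP) ^ (2*n+5) ∣ (CC.mV (3*n+2) (CC.eA n M0 M1 M2) : MvP)
  rw [CC.mV_coe (CC.mem_AD.1 (CC.eA_mem n M0 M1 M2 hn h)), X_pow_eq_monomial, monomial_dvd_monomial]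
  refine ⟨Or.inr ?_, dvd_refl _⟩
  rw [Finsupp.single_le_iff]
  show 2*n+5 ≤ 3*n-6+M0
  omega
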